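/- Let a > 0, L ≥ 1 and let g ∈ C²(ℝ) satisfy min_{x∈[−2a,2a]} g(x) = 4La, and set G := {(x,y) : x ∈ (−a,a), g(x) − La < y ≤ g(x)}. Let λ > 1 and μ > 1 be given parameters. Then for every 0 < p ≤ ∞ and all nonnegative integers r, i, j there is a constant c > 0, independent of f, n and μ, such that for every n ∈ ℕ and every f ∈ Π_n²: ‖ φ_n(x,y)^i · max_{|t| ≤ min{μ φ_n(x,y), a}} | D_{x+t}^r ∂₂^{i+j} f(x,y) | ‖_{L^p(G; dxdy)} ≤ c μ^r n^{r+2j+i} ‖f‖_{L^p(G(λ))}. -/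

import Mathlib

open MeasureTheory Set
open scoped ENNReal

noncomputable section

/-- Partial derivative `∂₁ = ∂/∂x` of a function on `ℝ²`. -/
def pd1 (f : ℝ × ℝ → ℝ) : ℝ × ℝ → ℝ := fun p => deriv (fun t => f (t, p.2)) p.1

/-- Partial derivative `∂₂ = ∂/∂y` of a function on `ℝ²`. -/
def pd2 (f : ℝ × ℝ → ℝ) : ℝ × ℝ → ℝ := fun p => deriv (fun t => f (p.1, t)) p.2

/-- The tangential derivative frozen at `x₀`:
`D_{x₀}^ℓ f = Σ_{i=0}^ℓ binom(ℓ,i) (g′(x₀))^i ∂₁^{ℓ−i} ∂₂^i f`. -/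
def DtanAt (g : ℝ → ℝ) (x₀ : ℝ) (ℓ : ℕ) (f : ℝ × ℝ → ℝ) : ℝ × ℝ → ℝ :=
  fun p => ∑ i ∈ Finset.range (ℓ + 1),
    (ℓ.choose i : ℝ) * deriv g x₀ ^ i * (pd1^[ℓ - i] (pd2^[i] f)) p

/-- The `ℓ`-th order tangential differential operator `D^{(ℓ)} f(x,y) = (D_x^ℓ f)(x,y)`. -/
def Dtan (g : ℝ → ℝ) (ℓ : ℕ) (f : ℝ × ℝ → ℝ) : ℝ × ℝ → ℝ :=
  fun p => DtanAt g p.1 ℓ f p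

/-- `f` is (the evaluation of) a real polynomial in two variables of total degree at most `n`. -/
def IsPoly2 (n : ℕ) (f : ℝ × ℝ → ℝ) : Prop :=
  ∃ P : MvPolynomial (Fin 2) ℝ, P.totalDegree ≤ n ∧
    ∀ p : ℝ × ℝ, f p = MvPolynomial.eval ![p.1, p.2] P

/-- The set `G(λ) = {(x,y) : x ∈ (−λa,λa), g(x) − λLa < y ≤ g(x)}`; `G = G(1)`. -/
def Gset (a L : ℝ) (g : ℝ → ℝ) (lam : ℝ) : Set (ℝ × ℝ) :=
  {p | p.1 ∈ Set.Ioo (-(lam * a)) (lam * a) ∧ g p.1 - lam * L * a < p.2 ∧ p.2 ≤ g p.1}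

/-- `φ_n(x,y) = √(g(x) − y) + 1/n`. -/
def phi2 (g : ℝ → ℝ) (n : ℕ) (p : ℝ × ℝ) : ℝ := Real.sqrt (g p.1 - p.2) + 1 / n

/-- Value of a bivariate polynomial at a point of the plane. -/
def evalAt (q : ℝ × ℝ) (P : MvPolynomial (Fin 2) ℝ) : ℝ := MvPolynomial.eval ![q.1, q.2] P

/-- The directional derivative `u ∂₁ + w ∂₂` on bivariate polynomials. -/
def dirDeriv (u w : ℝ) : Module.End ℝ (MvPolynomial (Fin 2) ℝ) :=
  u • (MvPolynomial.pderiv (R := ℝ) (0 : Fin 2)).toLinearMap +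
    w • (MvPolynomial.pderiv (R := ℝ) (1 : Fin 2)).toLinearMap

/-- The restriction of a bivariate polynomial to a line. -/
def lineMap (q e : ℝ × ℝ) : MvPolynomial (Fin 2) ℝ →ₐ[ℝ] Polynomial ℝ :=
  MvPolynomial.aeval ![Polynomial.C q.1 + Polynomial.C e.1 * Polynomial.X,
    Polynomial.C q.2 + Polynomial.C e.2 * Polynomial.X]

theorem dirDeriv_apply (u w : ℝ) (P : MvPolynomial (Fin 2) ℝ) :
    dirDeriv u w P = u • MvPolynomial.pderiv 0 P + w • MvPolynomial.pderiv 1 P := rfl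

theorem eval_lineMap (q e : ℝ × ℝ) (P : MvPolynomial (Fin 2) ℝ) (s : ℝ) :
    (lineMap q e P).eval s = evalAt (q.1 + s * e.1, q.2 + s * e.2) P := by
  induction P using MvPolynomial.induction_on with
  | C c => simp [lineMap, evalAt]
  | add P Q hP hQ => simp_all [evalAt]
  | mul_X P i hP =>
    rw [map_mul, Polynomial.eval_mul, hP]
    fin_cases i <;> simp [lineMap, evalAt] <;> ring_nf <;> simp

theorem derivative_lineMap (q e : ℝ × ℝ) (P : MvPolynomial (Fin 2) ℝ) :
    Polynomial.derivative (lineMap q e P) = lineMap q e (dirDeriv e.1 e.2 P) := by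
  induction P using MvPolynomial.induction_on with
  | C c => simp [lineMap, dirDeriv_apply]
  | add P Q hP hQ => simp_all
  | mul_X P i hP =>
    rw [map_mul, Polynomial.derivative_mul, hP]
    have hX : ∀ i, lineMap q e (MvPolynomial.X i) =
      (![Polynomial.C q.1 + Polynomial.C e.1 * Polynomial.X,
        Polynomial.C q.2 + Polynomial.C e.2 * Polynomial.X] : Fin 2 → Polynomial ℝ) i := by
      intro i; simp [lineMap]
    simp only [dirDeriv_apply, Derivation.leibniz, map_add, map_smul, smul_eq_mul, map_mul, hX]
    fin_cases i <;> simp [Polynomial.smul_eq_C_mul] <;> ring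

theorem natDegree_lineMap_le (q e : ℝ × ℝ) (P : MvPolynomial (Fin 2) ℝ) :
    (lineMap q e P).natDegree ≤ P.totalDegree := by
  have := MvPolynomial.aeval_natDegree_le (m := P.totalDegree) (n := 1) P le_rfl
    ![Polynomial.C q.1 + Polynomial.C e.1 * Polynomial.X,
      Polynomial.C q.2 + Polynomial.C e.2 * Polynomial.X] (by
        intro i
        fin_cases i <;> simp <;> compute_degree)
  simpa [lineMap] using this

theorem derivative_iterate_lineMap (q e : ℝ × ℝ) (P : MvPolynomial (Fin 2) ℝ) (k : ℕ) :
    Polynomial.derivative^[k] (lineMap q e P) = lineMap q e ((dirDeriv e.1 e.2 ^ k) P) := by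
  induction k with
  | zero => simp
  | succ k ih => rw [Function.iterate_succ_apply', ih, derivative_lineMap, pow_succ']; rfl

theorem totalDegree_dirDeriv_le (u w : ℝ) (P : MvPolynomial (Fin 2) ℝ) :
    (dirDeriv u w P).totalDegree ≤ P.totalDegree := by
  have key : ∀ i : Fin 2, (MvPolynomial.pderiv i P).totalDegree ≤ P.totalDegree := by
    intro i
    conv_lhs => rw [P.as_sum, map_sum]
    refine MvPolynomial.totalDegree_finsetSum_le fun s hs => ?_
    rw [MvPolynomial.pderiv_monomial]
    refine (MvPolynomial.totalDegree_monomial_le _ _).trans ?_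
    refine le_trans ?_ (MvPolynomial.le_totalDegree hs)
    have h : (s - Finsupp.single i 1) ≤ s := tsub_le_self
    exact Finsupp.degree_mono h
  rw [dirDeriv_apply]
  refine (MvPolynomial.totalDegree_add _ _).trans (max_le ?_ ?_)
  · exact (MvPolynomial.totalDegree_smul_le _ _).trans (key 0)
  · exact (MvPolynomial.totalDegree_smul_le _ _).trans (key 1)

theorem totalDegree_dirDeriv_pow_le (u w : ℝ) (k : ℕ) (P : MvPolynomial (Fin 2) ℝ) :
    ((dirDeriv u w ^ k) P).totalDegree ≤ P.totalDegree := by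
  induction k with
  | zero => simp
  | succ k ih => rw [pow_succ', Module.End.mul_apply]; exact (totalDegree_dirDeriv_le _ _ _).trans ih

/-- Taylor's formula along a line. -/
theorem evalAt_line (P : MvPolynomial (Fin 2) ℝ) {R : ℕ} (hR : P.totalDegree < R)
    (x y u w s : ℝ) :
    evalAt (x + s * u, y + s * w) P =
      ∑ l ∈ Finset.range R, evalAt (x, y) ((dirDeriv u w ^ l) P) / l.factorial * s ^ l := by
  have h := eval_lineMap (x, y) (u, w) P s
  simp only at h
  rw [← h, Polynomial.eval_eq_sum_range' ((natDegree_lineMap_le _ _ P).trans_lt hR)]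
  refine Finset.sum_congr rfl fun l _ => ?_
  congr 1
  have h2 := congrArg (fun Q => Polynomial.coeff Q 0) (derivative_iterate_lineMap (x, y) (u, w) P l)
  simp only at h2
  rw [Polynomial.coeff_iterate_derivative, Polynomial.coeff_zero_eq_eval_zero,
    eval_lineMap] at h2
  simp only [zero_add, zero_mul, add_zero, Nat.descFactorial_self, nsmul_eq_mul] at h2
  rw [← h2]
  field_simp

theorem pd1_evalAt (P : MvPolynomial (Fin 2) ℝ) :
    pd1 (fun q => evalAt q P) = fun q => evalAt q (dirDeriv 1 0 P) := by
  funext q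
  have h : (fun t => evalAt (t, q.2) P) = fun t => (lineMap (0, q.2) (1, 0) P).eval t := by
    funext t; rw [eval_lineMap]; simp
  rw [pd1]
  simp only [h]
  rw [Polynomial.deriv, derivative_lineMap, eval_lineMap]
  simp

theorem pd2_evalAt (P : MvPolynomial (Fin 2) ℝ) :
    pd2 (fun q => evalAt q P) = fun q => evalAt q (dirDeriv 0 1 P) := by
  funext q
  have h : (fun t => evalAt (q.1, t) P) = fun t => (lineMap (q.1, 0) (0, 1) P).eval t := by
    funext t; rw [eval_lineMap]; simp
  rw [pd2]
  simp only [h]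
  rw [Polynomial.deriv, derivative_lineMap, eval_lineMap]
  simp

theorem pd1_iterate_evalAt (k : ℕ) (P : MvPolynomial (Fin 2) ℝ) :
    pd1^[k] (fun q => evalAt q P) = fun q => evalAt q ((dirDeriv 1 0 ^ k) P) := by
  induction k with
  | zero => simp
  | succ k ih => rw [Function.iterate_succ_apply', ih, pd1_evalAt, pow_succ']; rfl

theorem pd2_iterate_evalAt (k : ℕ) (P : MvPolynomial (Fin 2) ℝ) :
    pd2^[k] (fun q => evalAt q P) = fun q => evalAt q ((dirDeriv 0 1 ^ k) P) := by
  induction k with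
  | zero => simp
  | succ k ih => rw [Function.iterate_succ_apply', ih, pd2_evalAt, pow_succ']; rfl

theorem dirDeriv_commute (u w u' w' : ℝ) : Commute (dirDeriv u w) (dirDeriv u' w') := by
  have h : Commute ((MvPolynomial.pderiv (R := ℝ) (0 : Fin 2)).toLinearMap :
      Module.End ℝ (MvPolynomial (Fin 2) ℝ))
      ((MvPolynomial.pderiv (R := ℝ) (1 : Fin 2)).toLinearMap :
      Module.End ℝ (MvPolynomial (Fin 2) ℝ)) := by
    have h2 : ⁅MvPolynomial.pderiv (R := ℝ) (0 : Fin 2),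
        MvPolynomial.pderiv (R := ℝ) (1 : Fin 2)⁆ = 0 := by
      refine MvPolynomial.derivation_ext fun i => ?_
      fin_cases i <;> simp [Derivation.commutator_apply]
    refine LinearMap.ext fun P => sub_eq_zero.mp ?_
    have h3 := congrArg (fun D => D P) h2
    simpa [Derivation.commutator_apply] using h3
  unfold dirDeriv
  have h0 := Commute.refl ((MvPolynomial.pderiv (R := ℝ) (0 : Fin 2)).toLinearMap :
      Module.End ℝ (MvPolynomial (Fin 2) ℝ))
  have h1 := Commute.refl ((MvPolynomial.pderiv (R := ℝ) (1 : Fin 2)).toLinearMap :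
      Module.End ℝ (MvPolynomial (Fin 2) ℝ))
  refine Commute.add_left (Commute.add_right ?_ ?_) (Commute.add_right ?_ ?_)
  · exact (h0.smul_left _).smul_right _
  · exact (h.smul_left _).smul_right _
  · exact (h.symm.smul_left _).smul_right _
  · exact (h1.smul_left _).smul_right _

/-- The binomial formula for a change of slope in an iterated directional derivative. -/
theorem dirDeriv_slope_pow (d d' : ℝ) (r : ℕ) (P : MvPolynomial (Fin 2) ℝ) :
    (dirDeriv 1 d' ^ r) P = ∑ k ∈ Finset.range (r + 1),
      ((r.choose k : ℝ) * (d' - d) ^ k) • (dirDeriv 1 d ^ (r - k)) ((dirDeriv 0 1 ^ k) P) := by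
  have hsplit : dirDeriv 1 d' = (d' - d) • dirDeriv 0 1 + dirDeriv 1 d := by
    simp only [dirDeriv, zero_smul, zero_add, one_smul]
    module
  rw [hsplit, ((dirDeriv_commute 0 1 1 d).smul_left _).add_pow, LinearMap.sum_apply]
  refine Finset.sum_congr rfl fun k _ => ?_
  rw [smul_pow, smul_mul_assoc, ((dirDeriv_commute 0 1 1 d).pow_pow _ _).eq, mul_comm (_ : ℝ),
    mul_smul, ← nsmul_eq_mul', Nat.cast_smul_eq_nsmul, smul_comm]
  rfl

theorem DtanAt_pd2_evalAt (g : ℝ → ℝ) (x₀ : ℝ) (r k : ℕ) (P : MvPolynomial (Fin 2) ℝ)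
    (q : ℝ × ℝ) :
    DtanAt g x₀ r (pd2^[k] (fun q => evalAt q P)) q =
      evalAt q ((dirDeriv 1 (deriv g x₀) ^ r) ((dirDeriv 0 1 ^ k) P)) := by
  rw [dirDeriv_slope_pow 0]
  simp only [DtanAt, pd2_iterate_evalAt, pd1_iterate_evalAt, sub_zero]
  simp only [evalAt, map_sum, MvPolynomial.smul_eval]

theorem sum_mul_pow_eq_zero_of_forall_mem_Icc (d : ℕ) (u : ℝ) (c : Fin (d + 1) → ℝ)
    (h : ∀ z ∈ Icc u (u + 1), ∑ k, c k * z ^ (k : ℕ) = 0) : c = 0 := by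
  have hP : (∑ k, Polynomial.C (c k) * Polynomial.X ^ (k : ℕ) : Polynomial ℝ) = 0 := by
    refine Polynomial.eq_zero_of_infinite_isRoot _ (Set.Infinite.mono ?_
      (Icc_infinite (show u < u + 1 by linarith)))
    intro z hz
    simpa [Polynomial.IsRoot, Polynomial.eval_finsetSum] using h z hz
  funext k
  have := congrArg (fun Q => Polynomial.coeff Q k) hP
  simpa [Polynomial.finsetSum_coeff, Polynomial.coeff_X_pow, Fin.val_inj] using this

theorem exists_le_integral_abs_sum_rpow (d : ℕ) (u : ℝ) {p : ℝ} (hp : 0 < p) :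
    ∃ ε : ℝ, 0 < ε ∧ ∀ c : Fin (d + 1) → ℝ,
      ε * ‖c‖ ^ p ≤ ∫ z in u..(u + 1), |∑ k, c k * z ^ (k : ℕ)| ^ p := by
  have hcont2 : Continuous (fun x : (Fin (d + 1) → ℝ) × ℝ =>
      |∑ k, x.1 k * x.2 ^ (k : ℕ)| ^ p) := by
    refine Continuous.rpow_const (by fun_prop) fun _ => Or.inr hp.le
  have hcont : Continuous (fun c : Fin (d + 1) → ℝ =>
      ∫ z in u..(u + 1), |∑ k, c k * z ^ (k : ℕ)| ^ p) :=
    intervalIntegral.continuous_parametric_intervalIntegral_of_continuous' hcont2 _ _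
  obtain ⟨c₀, hc₀, hmin⟩ := (isCompact_sphere (0 : Fin (d + 1) → ℝ) 1).exists_isMinOn
    (NormedSpace.sphere_nonempty.mpr zero_le_one) hcont.continuousOn
  have hc₀n : ‖c₀‖ = 1 := by simpa using hc₀
  refine ⟨∫ z in u..(u + 1), |∑ k, c₀ k * z ^ (k : ℕ)| ^ p, ?_, fun c => ?_⟩
  · have hex : ∃ z ∈ Icc u (u + 1), ∑ k, c₀ k * z ^ (k : ℕ) ≠ 0 := by
      by_contra! hcon
      rw [sum_mul_pow_eq_zero_of_forall_mem_Icc d u c₀ hcon] at hc₀n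
      simp at hc₀n
    obtain ⟨z, hz, hne⟩ := hex
    refine intervalIntegral.integral_pos (by linarith) ?_ (fun _ _ => by positivity)
      ⟨z, hz, by positivity⟩
    exact (hcont2.comp (by fun_prop : Continuous fun z : ℝ => (c₀, z))).continuousOn
  · rcases eq_or_ne c 0 with rfl | hc
    · simp [Real.zero_rpow hp.ne']
    have hcn : 0 < ‖c‖ := norm_pos_iff.mpr hc
    have h1 := hmin (show ‖c‖⁻¹ • c ∈ Metric.sphere (0 : Fin (d + 1) → ℝ) 1 by
      simp [norm_smul, hcn.ne'])
    simp only [mem_ofPred_eq] at h1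
    have h2 : ∀ z : ℝ, |∑ k, (‖c‖⁻¹ • c) k * z ^ (k : ℕ)| ^ p =
        (‖c‖ ^ p)⁻¹ * |∑ k, c k * z ^ (k : ℕ)| ^ p := by
      intro z
      simp only [Pi.smul_apply, smul_eq_mul, mul_assoc]
      rw [← Finset.mul_sum, abs_mul, Real.mul_rpow (abs_nonneg _) (abs_nonneg _),
        abs_of_pos (by positivity), Real.inv_rpow hcn.le]
    simp only [h2, intervalIntegral.integral_const_mul] at h1
    have h3 := mul_le_mul_of_nonneg_left h1 (Real.rpow_nonneg hcn.le p)
    rw [← mul_assoc, mul_inv_cancel₀ (by positivity), one_mul] at h3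
    linarith

/-- The coefficients of a univariate polynomial of bounded degree are controlled by its `L^p`
quasi-norm on an interval of length one. -/
theorem enorm_coeff_rpow_le_lintegral (d : ℕ) (u : ℝ) {p : ℝ} (hp : 0 < p) :
    ∃ C : ℝ≥0∞, C ≠ ∞ ∧ ∀ c : ℕ → ℝ, ∀ e ∈ Finset.range (d + 1),
      ‖c e‖ₑ ^ p ≤
        C * ∫⁻ z in Icc u (u + 1), ‖∑ k ∈ Finset.range (d + 1), c k * z ^ k‖ₑ ^ p := by
  obtain ⟨ε, hε, h⟩ := exists_le_integral_abs_sum_rpow d u hp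
  refine ⟨ENNReal.ofReal ε⁻¹, ENNReal.ofReal_ne_top, fun c e he => ?_⟩
  have h1 := h fun k => c k
  have h2 : |c e| ≤ ‖fun k : Fin (d + 1) => c k‖ :=
    norm_le_pi_norm (fun k : Fin (d + 1) => c k) ⟨e, Finset.mem_range.mp he⟩
  have h3 : |c e| ^ p ≤ ε⁻¹ *
      ∫ z in u..(u + 1), |∑ k ∈ Finset.range (d + 1), c k * z ^ k| ^ p := by
    simp only [Finset.sum_range]
    rw [← div_eq_inv_mul, le_div_iff₀ hε, mul_comm]
    refine le_trans ?_ h1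
    gcongr
  have hcont : Continuous fun z : ℝ => |∑ k ∈ Finset.range (d + 1), c k * z ^ k| ^ p :=
    Continuous.rpow_const (by fun_prop) fun _ => Or.inr hp.le
  have h4 : ∀ t : ℝ, ‖t‖ₑ ^ p = ENNReal.ofReal (|t| ^ p) := fun t => by
    rw [← ENNReal.ofReal_rpow_of_nonneg (abs_nonneg _) hp.le, ← Real.norm_eq_abs,
      ofReal_norm]
  simp only [h4]
  refine (ENNReal.ofReal_le_ofReal h3).trans_eq ?_
  rw [ENNReal.ofReal_mul (by positivity), intervalIntegral.integral_of_le (by linarith),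
    ← integral_Icc_eq_integral_Ioc, ofReal_integral_eq_lintegral_ofReal]
  · exact hcont.continuousOn.integrableOn_Icc
  · exact Filter.Eventually.of_forall fun _ => by positivity

theorem sub_le_of_mem_parabolaBand {s c v₁ v₂ : ℝ} (hv₁ : 0 ≤ v₁) (hlt : v₁ < v₂)
    (h₁ : ∃ z ∈ Icc (1 : ℝ) 2, v₁ ^ 2 - z * v₁ * s = c)
    (h₂ : ∃ z ∈ Icc (1 : ℝ) 2, v₂ ^ 2 - z * v₂ * s = c) : v₂ - v₁ ≤ 2 * |s| := by
  obtain ⟨z₁, ⟨hz₁, hz₁'⟩, h₁⟩ := h₁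
  obtain ⟨z₂, ⟨hz₂, hz₂'⟩, h₂⟩ := h₂
  by_contra! hcon
  rcases le_total 0 s with hs | hs
  · rw [abs_of_nonneg hs] at hcon
    have e1 : v₁ * s ≤ z₁ * v₁ * s := by nlinarith [mul_nonneg hv₁ hs]
    have e2 : z₂ * v₂ * s ≤ 2 * (v₂ * s) := by nlinarith [mul_nonneg (hv₁.trans hlt.le) hs]
    nlinarith [mul_nonneg hv₁ hs, mul_pos (show 0 < v₂ - v₁ - 2 * s by linarith)
      (show 0 < v₂ - v₁ by linarith), mul_nonneg hv₁ (show 0 ≤ v₂ - v₁ - 2 * s by linarith)]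
  · rw [abs_of_nonpos hs] at hcon
    have hs' : 0 ≤ -s := by linarith
    have e1 : z₁ * v₁ * (-s) ≤ 2 * (v₁ * (-s)) := by nlinarith [mul_nonneg hv₁ hs']
    have e2 : v₂ * (-s) ≤ z₂ * v₂ * (-s) := by nlinarith [mul_nonneg (hv₁.trans hlt.le) hs']
    nlinarith [mul_nonneg hv₁ hs', mul_pos (show 0 < v₂ - v₁ by linarith)
      (show 0 < v₂ - v₁ by linarith), mul_nonneg hv₁ (show 0 ≤ v₂ - v₁ by linarith)]

theorem lintegral_comp_sub_mul {Φ : ℝ → ℝ≥0∞} (hΦ : Measurable Φ) (c : ℝ) {a : ℝ} (ha : a ≠ 0) :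
    ∫⁻ z, Φ (c - z * a) = ENNReal.ofReal |a⁻¹| * ∫⁻ τ, Φ τ := by
  rw [← lintegral_sub_left_eq_self Φ c]
  have h := lintegral_map (μ := volume) (f := fun τ => Φ (c - τ)) (g := fun z : ℝ => z * a)
    (hΦ.comp (by fun_prop)) (by fun_prop)
  rw [← h, Real.map_volume_mul_right ha, lintegral_smul_measure, smul_eq_mul]

theorem lintegral_inv_sqrt_Icc_sq {v D : ℝ} (hv : 0 ≤ v) (hD : 0 ≤ D) :
    ∫⁻ w in Icc (v ^ 2) ((v + D) ^ 2), ENNReal.ofReal (w ^ (-(1 / 2) : ℝ)) =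
      ENNReal.ofReal (2 * D) := by
  have hle : v ^ 2 ≤ (v + D) ^ 2 := by gcongr; linarith
  have hint := intervalIntegral.intervalIntegrable_rpow' (a := v ^ 2) (b := (v + D) ^ 2)
    (show (-1 : ℝ) < -(1 / 2) by norm_num)
  have h := integral_rpow (a := v ^ 2) (b := (v + D) ^ 2) (r := -(1 / 2)) (Or.inl (by norm_num))
  rw [intervalIntegral.integral_of_le hle, ← integral_Icc_eq_integral_Ioc] at h
  rw [← ofReal_integral_eq_lintegral_ofReal, h]
  · have e : (-(1 / 2) + 1 : ℝ) = 1 / 2 := by norm_num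
    rw [e, ← Real.sqrt_eq_rpow, ← Real.sqrt_eq_rpow, Real.sqrt_sq hv, Real.sqrt_sq (by linarith)]
    congr 1; ring
  · exact (integrableOn_Icc_iff_integrableOn_Ioc).mpr
      ((intervalIntegrable_iff_integrableOn_Ioc_of_le hle).mp hint)
  · filter_upwards [ae_restrict_mem measurableSet_Icc] with w hw
    exact Real.rpow_nonneg ((sq_nonneg v).trans hw.1) _

theorem lintegral_inv_sqrt_parabolaBand_le (s τ : ℝ) :
    ∫⁻ w in Ioi 0, {w : ℝ | ∃ z ∈ Icc (1 : ℝ) 2, w - z * (√w * s) = τ}.indicator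
      (fun w => ENNReal.ofReal (w ^ (-(1 / 2) : ℝ))) w ≤ ENNReal.ofReal (4 * |s|) := by
  set V : Set ℝ := {v | 0 ≤ v ∧ ∃ z ∈ Icc (1 : ℝ) 2, v ^ 2 - z * v * s = τ} with hV
  have hbdd : BddBelow V := ⟨0, fun v hv => hv.1⟩
  have h0 : 0 ≤ sInf V := Real.sInf_nonneg fun v hv => hv.1
  have hmem : ∀ v ∈ V, sInf V ≤ v ∧ v ≤ sInf V + 2 * |s| := by
    intro v hv
    refine ⟨csInf_le hbdd hv, ?_⟩
    rw [← sub_le_iff_le_add]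
    refine le_csInf ⟨v, hv⟩ fun v' hv' => ?_
    rcases lt_or_ge v' v with hlt | hge
    · have := sub_le_of_mem_parabolaBand hv'.1 hlt hv'.2 hv.2
      linarith
    · have := abs_nonneg s
      linarith
  have hle : ∀ w ∈ Ioi (0 : ℝ), {w : ℝ | ∃ z ∈ Icc (1 : ℝ) 2, w - z * (√w * s) = τ}.indicator
      (fun w => ENNReal.ofReal (w ^ (-(1 / 2) : ℝ))) w ≤
      (Icc (sInf V ^ 2) ((sInf V + 2 * |s|) ^ 2)).indicator
        (fun w => ENNReal.ofReal (w ^ (-(1 / 2) : ℝ))) w := by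
    intro w hw
    have hw0 : 0 ≤ w := le_of_lt hw
    by_cases hw' : w ∈ {w : ℝ | ∃ z ∈ Icc (1 : ℝ) 2, w - z * (√w * s) = τ}
    · obtain ⟨z, hz, hzw⟩ := id hw'
      have hv := hmem (√w) ⟨Real.sqrt_nonneg _, z, hz, by rw [Real.sq_sqrt hw0, ← hzw]; ring⟩
      rw [indicator_of_mem hw', indicator_of_mem]
      refine ⟨?_, ?_⟩
      · rw [← Real.sq_sqrt hw0]; gcongr; exact hv.1
      · nth_rewrite 1 [← Real.sq_sqrt hw0]; gcongr; exact hv.2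
    · rw [indicator_of_notMem hw']
      exact zero_le
  calc _ ≤ ∫⁻ w in Ioi 0, (Icc (sInf V ^ 2) ((sInf V + 2 * |s|) ^ 2)).indicator
        (fun w => ENNReal.ofReal (w ^ (-(1 / 2) : ℝ))) w :=
        setLIntegral_mono' measurableSet_Ioi hle
    _ ≤ ∫⁻ w, (Icc (sInf V ^ 2) ((sInf V + 2 * |s|) ^ 2)).indicator
        (fun w => ENNReal.ofReal (w ^ (-(1 / 2) : ℝ))) w := setLIntegral_le_lintegral _ _
    _ = ENNReal.ofReal (4 * |s|) := by
        rw [lintegral_indicator measurableSet_Icc, lintegral_inv_sqrt_Icc_sq h0 (by positivity)]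
        congr 1; ring

/-- Averaging over the parameter `z` makes the family of maps `w ↦ w - z √w s` bounded on `L¹`,
uniformly in `s`. -/
theorem lintegral_lintegral_sub_mul_sqrt_le {Φ : ℝ → ℝ≥0∞} (hΦ : Measurable Φ) {s : ℝ}
    (hs : s ≠ 0) :
    ∫⁻ w in Ioi 0, ∫⁻ z in Icc (1 : ℝ) 2, Φ (w - z * (√w * s)) ≤ 4 * ∫⁻ τ, Φ τ := by
  set E : Set (ℝ × ℝ) := {x | 1 ≤ (x.1 - x.2) / (√x.1 * s) ∧ (x.1 - x.2) / (√x.1 * s) ≤ 2}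
  have hE : MeasurableSet E :=
    MeasurableSet.inter (s₁ := {x : ℝ × ℝ | 1 ≤ (x.1 - x.2) / (√x.1 * s)})
      (s₂ := {x : ℝ × ℝ | (x.1 - x.2) / (√x.1 * s) ≤ 2})
      (measurableSet_le (by fun_prop) (by fun_prop)) (measurableSet_le (by fun_prop) (by fun_prop))
  have hmemE : ∀ w ∈ Ioi (0 : ℝ), ∀ τ, (w, τ) ∈ E ↔
      w ∈ {w : ℝ | ∃ z ∈ Icc (1 : ℝ) 2, w - z * (√w * s) = τ} := by
    intro w hw τ
    have hne : √w * s ≠ 0 := mul_ne_zero (Real.sqrt_pos.mpr hw).ne' hs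
    constructor
    · intro h
      exact ⟨_, h, by rw [div_mul_cancel₀ _ hne]; ring⟩
    · rintro ⟨z, hz, rfl⟩
      have h : (w - (w - z * (√w * s))) / (√w * s) = z := by
        rw [sub_sub_cancel, mul_div_cancel_right₀ _ hne]
      show 1 ≤ (w - (w - z * (√w * s))) / (√w * s) ∧ (w - (w - z * (√w * s))) / (√w * s) ≤ 2
      rwa [h]
  have hEm : Measurable fun x : ℝ × ℝ => E.indicator (fun x => Φ x.2) x :=
    (hΦ.comp measurable_snd).indicator hE
  calc _ ≤ ∫⁻ w in Ioi 0, ∫⁻ τ, ENNReal.ofReal |s|⁻¹ *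
        (E.indicator (fun x => Φ x.2) (w, τ) * ENNReal.ofReal (w ^ (-(1 / 2) : ℝ))) := by
        refine setLIntegral_mono' measurableSet_Ioi fun w hw => ?_
        have hne : √w * s ≠ 0 := mul_ne_zero (Real.sqrt_pos.mpr hw).ne' hs
        have hmw : Measurable fun τ => E.indicator (fun x => Φ x.2) (w, τ) :=
          hEm.comp (by fun_prop)
        calc _ = ∫⁻ z in Icc (1 : ℝ) 2, E.indicator (fun x => Φ x.2) (w, w - z * (√w * s)) := by
              refine setLIntegral_congr_fun measurableSet_Icc fun z hz => ?_
              rw [indicator_of_mem ((hmemE w hw _).mpr ⟨z, hz, rfl⟩)]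
          _ ≤ ∫⁻ z, E.indicator (fun x => Φ x.2) (w, w - z * (√w * s)) :=
              setLIntegral_le_lintegral _ _
          _ = _ := by
              rw [lintegral_comp_sub_mul hmw w hne, lintegral_const_mul _ (by fun_prop),
                lintegral_mul_const _ hmw, mul_inv, abs_mul, abs_inv, abs_inv,
                abs_of_nonneg (Real.sqrt_nonneg w), ENNReal.ofReal_mul (by positivity),
                Real.rpow_neg (le_of_lt hw), Real.sqrt_eq_rpow]
              ring
    _ = ∫⁻ τ, ENNReal.ofReal |s|⁻¹ * (Φ τ * ∫⁻ w in Ioi 0,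
        {w : ℝ | ∃ z ∈ Icc (1 : ℝ) 2, w - z * (√w * s) = τ}.indicator
          (fun w => ENNReal.ofReal (w ^ (-(1 / 2) : ℝ))) w) := by
        rw [lintegral_lintegral_swap (by fun_prop)]
        refine lintegral_congr fun τ => ?_
        have hm2 : Measurable fun w => E.indicator (fun x => Φ x.2) (w, τ) :=
          hEm.comp (by fun_prop)
        rw [lintegral_const_mul _ (by fun_prop)]
        congr 1
        have hm1 : Measurable fun w : ℝ =>
            {w : ℝ | (w, τ) ∈ E}.indicator (fun w => ENNReal.ofReal (w ^ (-(1 / 2) : ℝ))) w :=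
          Measurable.indicator (by fun_prop) (hE.preimage (by fun_prop))
        have hc : ∫⁻ w in Ioi 0, {w : ℝ | ∃ z ∈ Icc (1 : ℝ) 2, w - z * (√w * s) = τ}.indicator
            (fun w => ENNReal.ofReal (w ^ (-(1 / 2) : ℝ))) w =
            ∫⁻ w in Ioi 0, {w : ℝ | (w, τ) ∈ E}.indicator
              (fun w => ENNReal.ofReal (w ^ (-(1 / 2) : ℝ))) w := by
          refine setLIntegral_congr_fun measurableSet_Ioi fun w hw => ?_
          by_cases h : (w, τ) ∈ E
          · rw [indicator_of_mem ((hmemE w hw τ).mp h),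
              indicator_of_mem (s := {w | (w, τ) ∈ E}) h]
          · rw [indicator_of_notMem (mt (hmemE w hw τ).mpr h),
              indicator_of_notMem (s := {w | (w, τ) ∈ E}) h]
        rw [hc, ← lintegral_const_mul _ hm1]
        refine setLIntegral_congr_fun measurableSet_Ioi fun w hw => ?_
        by_cases h : (w, τ) ∈ E <;> simp [h]
    _ ≤ ∫⁻ τ, ENNReal.ofReal |s|⁻¹ * (Φ τ * ENNReal.ofReal (4 * |s|)) := by
        gcongr
        exact lintegral_inv_sqrt_parabolaBand_le s _
    _ = 4 * ∫⁻ τ, Φ τ := by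
        rw [← lintegral_const_mul _ hΦ]
        refine lintegral_congr fun τ => ?_
        rw [mul_comm (Φ τ), ← mul_assoc, ← ENNReal.ofReal_mul (by positivity)]
        congr 1
        have : |s|⁻¹ * (4 * |s|) = 4 := by
          have := abs_pos.mpr hs
          field_simp
        rw [this]; norm_num

theorem lintegral_lintegral_add_mul_sqrt_le {Φ : ℝ → ℝ≥0∞} (hΦ : Measurable Φ) (b c : ℝ) {s : ℝ}
    (hs : s ≠ 0) :
    ∫⁻ y in Iio b, ∫⁻ z in Icc (1 : ℝ) 2, Φ (y + z * (√(b - y) * s) + c) ≤ 4 * ∫⁻ y, Φ y := by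
  have h := lintegral_lintegral_sub_mul_sqrt_le
    (Φ := fun τ => Φ (b + c - τ)) (hΦ.comp (by fun_prop)) hs
  rw [lintegral_sub_left_eq_self Φ (b + c)] at h
  refine le_trans (le_of_eq ?_) h
  rw [← lintegral_indicator measurableSet_Iio, ← lintegral_indicator measurableSet_Ioi,
    ← lintegral_sub_left_eq_self _ b]
  refine lintegral_congr fun w => ?_
  by_cases hw : 0 < w
  · rw [indicator_of_mem (by simpa using hw), indicator_of_mem (by simpa using hw)]
    refine lintegral_congr fun z => ?_
    rw [sub_sub_cancel]
    congr 1; ring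
  · rw [indicator_of_notMem (by simpa using hw), indicator_of_notMem (by simpa using hw)]

open scoped FourierTransform SchwartzMap ContDiff in
/-- A Schwartz kernel that reproduces `r`-th derivatives of functions band-limited to `[-1, 1]`. -/
theorem exists_schwartz_multiplier (r : ℕ) :
    ∃ ψ : 𝓢(ℝ, ℂ), ∀ ξ ∈ Icc (-1 : ℝ) 1,
      ∫ t : ℝ, Complex.exp (ξ * t * Complex.I) * ψ t = (Complex.I * ξ) ^ r := by
  let χ : ContDiffBump (0 : ℝ) := ⟨1, 2, by norm_num, by norm_num⟩
  let f : ℝ → ℂ := fun w => (χ w : ℂ) * (Complex.I * ((-2 * Real.pi * w : ℝ) : ℂ)) ^ r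
  have hf : ContDiff ℝ ∞ f := by
    refine ContDiff.mul (Complex.ofRealCLM.contDiff.comp χ.contDiff) ?_
    refine ContDiff.pow (contDiff_const.mul (Complex.ofRealCLM.contDiff.comp ?_)) _
    exact contDiff_const.mul contDiff_id
  have hs : HasCompactSupport f := by
    refine HasCompactSupport.mul_right ?_
    exact χ.hasCompactSupport.comp_left (g := fun x : ℝ => (x : ℂ)) (by simp)
  let F : 𝓢(ℝ, ℂ) := hs.toSchwartzMap hf
  refine ⟨𝓕⁻ F, fun ξ hξ => ?_⟩
  have h1 : 𝓕 (𝓕⁻ F) = F := FourierTransform.fourier_fourierInv_eq F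
  have hpi := Real.pi_gt_three
  have h2 := DFunLike.congr_fun h1 (-(ξ / (2 * Real.pi)))
  rw [SchwartzMap.fourier_coe, Real.fourier_eq'] at h2
  have hb : χ (-(ξ / (2 * Real.pi))) = 1 := by
    refine χ.one_of_mem_closedBall ?_
    rw [mem_closedBall_zero_iff, Real.norm_eq_abs, abs_neg, abs_div, abs_of_pos (by positivity :
      0 < 2 * Real.pi), div_le_iff₀ (by positivity)]
    have := abs_le.mpr hξ
    show |ξ| ≤ 1 * _
    linarith
  have hF : F (-(ξ / (2 * Real.pi))) = (Complex.I * ξ) ^ r := by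
    show f _ = _
    simp only [f, hb]
    have : -2 * Real.pi * -(ξ / (2 * Real.pi)) = ξ := by field_simp
    rw [this]; simp
  rw [hF] at h2
  rw [← h2]
  congr 1
  funext t
  rw [smul_eq_mul]
  congr 2
  have : -2 * Real.pi * inner ℝ t (-(ξ / (2 * Real.pi))) = ξ * t := by
    simp; field_simp
  rw [this]; push_cast; ring

/-- Finite linear combinations of the exponentials `t ↦ exp (i ξ t)`, `|ξ| ≤ 1`. -/
def bandLimited : Submodule ℂ (ℝ → ℂ) :=
  Submodule.span ℂ ((fun ξ : ℝ => fun t : ℝ => Complex.exp (ξ * t * Complex.I)) '' Icc (-1) 1)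

theorem iteratedDeriv_exp_mul_I (ξ : ℝ) (r : ℕ) :
    iteratedDeriv r (fun t : ℝ => Complex.exp (ξ * t * Complex.I)) =
      fun t : ℝ => (Complex.I * ξ) ^ r * Complex.exp (ξ * t * Complex.I) := by
  induction r with
  | zero => simp
  | succ r ih =>
    rw [iteratedDeriv_succ, ih]
    funext t
    have h : HasDerivAt (fun t : ℝ => Complex.exp (ξ * t * Complex.I))
        (Complex.exp (ξ * t * Complex.I) * (ξ * 1 * Complex.I)) t :=
      (((Complex.ofRealCLM.hasDerivAt (x := t)).const_mul (ξ : ℂ)).mul_const Complex.I).cexp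
    rw [(h.const_mul _).deriv]
    ring

open scoped ContDiff in
theorem contDiff_of_mem_bandLimited {U : ℝ → ℂ} (hU : U ∈ bandLimited) : ContDiff ℝ ∞ U := by
  induction hU using Submodule.span_induction with
  | mem x h =>
    obtain ⟨ξ, -, rfl⟩ := h
    exact (((contDiff_const.mul Complex.ofRealCLM.contDiff).mul contDiff_const)).cexp
  | zero => exact contDiff_const
  | add x y _ _ hx hy => exact hx.add hy
  | smul c x _ hx => exact contDiff_const.mul hx

theorem exists_norm_le_of_mem_bandLimited {U : ℝ → ℂ} (hU : U ∈ bandLimited) :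
    ∃ B : ℝ, ∀ t, ‖U t‖ ≤ B := by
  induction hU using Submodule.span_induction with
  | mem x h =>
    obtain ⟨ξ, -, rfl⟩ := h
    refine ⟨1, fun t => ?_⟩
    have : (ξ * t * Complex.I : ℂ) = ((ξ * t : ℝ) : ℂ) * Complex.I := by push_cast; ring
    simp only [this, Complex.norm_exp_ofReal_mul_I, le_refl]
  | zero => exact ⟨0, fun t => by simp⟩
  | add x y _ _ hx hy =>
    obtain ⟨B, hB⟩ := hx
    obtain ⟨B', hB'⟩ := hy
    exact ⟨B + B', fun t => (norm_add_le _ _).trans (add_le_add (hB t) (hB' t))⟩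
  | smul c x _ hx =>
    obtain ⟨B, hB⟩ := hx
    refine ⟨‖c‖ * B, fun t => ?_⟩
    rw [Pi.smul_apply, norm_smul]
    exact mul_le_mul_of_nonneg_left (hB t) (norm_nonneg _)

open scoped SchwartzMap ContDiff in
theorem iteratedDeriv_eq_integral_of_mem_bandLimited {r : ℕ} {ψ : 𝓢(ℝ, ℂ)}
    (hψ : ∀ ξ ∈ Icc (-1 : ℝ) 1,
      ∫ t : ℝ, Complex.exp (ξ * t * Complex.I) * ψ t = (Complex.I * ξ) ^ r)
    {U : ℝ → ℂ} (hU : U ∈ bandLimited) (τ : ℝ) :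
    iteratedDeriv r U τ = ∫ t, U (τ + t) * ψ t := by
  have hint : ∀ V ∈ bandLimited, Integrable (fun t => V (τ + t) * ψ t) := by
    intro V hV
    obtain ⟨B, hB⟩ := exists_norm_le_of_mem_bandLimited hV
    refine ψ.integrable.bdd_mul ?_ (Filter.Eventually.of_forall fun t => hB (τ + t))
    exact ((contDiff_of_mem_bandLimited hV).continuous.comp (by fun_prop)).aestronglyMeasurable
  have hr : ((r : ℕ∞) : WithTop ℕ∞) ≤ (∞ : WithTop ℕ∞) := by exact_mod_cast le_top
  induction hU using Submodule.span_induction with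
  | mem x h =>
    obtain ⟨ξ, hξ, rfl⟩ := h
    rw [iteratedDeriv_exp_mul_I, ← hψ ξ hξ]
    simp only
    rw [mul_comm, ← integral_const_mul]
    congr 1
    funext t
    rw [← mul_assoc, ← Complex.exp_add]
    congr 2
    push_cast; ring
  | zero =>
    have : (0 : ℝ → ℂ) = fun _ => 0 := rfl
    simp [this]
  | add x y hx' hy' hx hy =>
    rw [iteratedDeriv_add ((contDiff_of_mem_bandLimited hx').of_le hr).contDiffAt
      ((contDiff_of_mem_bandLimited hy').of_le hr).contDiffAt, hx, hy,
      ← integral_add (hint x hx') (hint y hy')]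
    simp only [Pi.add_apply, add_mul]
  | smul c x hx' hx =>
    rw [iteratedDeriv_const_smul ((contDiff_of_mem_bandLimited hx').of_le hr).contDiffAt, hx,
      ← integral_smul]
    simp only [Pi.smul_apply, smul_eq_mul, mul_assoc]

theorem span_exp_mul_sin_mem {K ω : ℝ} {U : ℝ → ℂ} (hω : 0 ≤ ω)
    (hU : U ∈ Submodule.span ℂ
      ((fun ξ : ℝ => fun t : ℝ => Complex.exp (ξ * t * Complex.I)) '' Icc (-K) K)) :
    (fun t => U t * ((Real.sin (t * ω) : ℝ) : ℂ)) ∈ Submodule.span ℂ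
      ((fun ξ : ℝ => fun t : ℝ => Complex.exp (ξ * t * Complex.I)) '' Icc (-(K + ω)) (K + ω)) := by
  induction hU using Submodule.span_induction with
  | mem x h =>
    obtain ⟨ξ, hξ, rfl⟩ := h
    have h1 : ∀ η : ℝ, |η| ≤ ω → (fun t : ℝ => Complex.exp ((ξ + η : ℝ) * t * Complex.I)) ∈
        Submodule.span ℂ ((fun ξ : ℝ => fun t : ℝ => Complex.exp (ξ * t * Complex.I)) ''
          Icc (-(K + ω)) (K + ω)) := by
      intro η hη
      have := abs_le.mp hη
      exact Submodule.subset_span ⟨ξ + η, ⟨by linarith [hξ.1], by linarith [hξ.2]⟩, rfl⟩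
    have h2 := Submodule.smul_mem _ (Complex.I / 2) (Submodule.sub_mem _
      (h1 (-ω) (by simp [abs_of_nonneg hω])) (h1 ω (by simp [abs_of_nonneg hω])))
    convert h2 using 1
    funext t
    simp only [Pi.smul_apply, Pi.sub_apply, smul_eq_mul, Complex.ofReal_sin, Complex.sin]
    have e1 : ((ξ + -ω : ℝ) * t * Complex.I : ℂ) = ξ * t * Complex.I + -(t * ω : ℝ) * Complex.I := by
      push_cast; ring
    have e2 : ((ξ + ω : ℝ) * t * Complex.I : ℂ) = ξ * t * Complex.I + (t * ω : ℝ) * Complex.I := by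
      push_cast; ring
    rw [e1, e2, Complex.exp_add, Complex.exp_add]
    ring
  | zero =>
    simp only [Pi.zero_apply, zero_mul]
    exact Submodule.zero_mem _
  | add x y _ _ hx hy =>
    convert Submodule.add_mem _ hx hy using 1
    funext t
    simp [add_mul]
  | smul c x _ hx =>
    convert Submodule.smul_mem _ c hx using 1
    funext t
    simp [mul_assoc]

theorem sin_pow_mem_span_exp {ω : ℝ} (hω : 0 ≤ ω) (j : ℕ) :
    (fun t : ℝ => ((Real.sin (t * ω) : ℝ) : ℂ) ^ j) ∈ Submodule.span ℂ
      ((fun ξ : ℝ => fun t : ℝ => Complex.exp (ξ * t * Complex.I)) '' Icc (-(j * ω)) (j * ω)) := by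
  induction j with
  | zero => exact Submodule.subset_span ⟨0, by simp, by simp⟩
  | succ j ih =>
    have := span_exp_mul_sin_mem hω ih
    simp only [pow_succ]
    convert this using 4 <;> · push_cast; ring

/-- The pullback of a polynomial by `t ↦ b sin (ω t)`. -/
def sinPullback (b ω : ℝ) (F : Polynomial ℝ) (t : ℝ) : ℂ := ((F.eval (b * Real.sin (t * ω)) : ℝ) : ℂ)

theorem sinPullback_mem_bandLimited {N : ℕ} (hN : 0 < N) (b : ℝ) {F : Polynomial ℝ}
    (hF : F.natDegree ≤ N) : sinPullback b (N : ℝ)⁻¹ F ∈ bandLimited := by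
  have hN' : (0 : ℝ) < N := by exact_mod_cast hN
  have key : sinPullback b (N : ℝ)⁻¹ F = ∑ k ∈ Finset.range (F.natDegree + 1),
      ((F.coeff k * b ^ k : ℝ) : ℂ) • fun t : ℝ => ((Real.sin (t * (N : ℝ)⁻¹) : ℝ) : ℂ) ^ k := by
    funext t
    rw [sinPullback, Polynomial.eval_eq_sum_range, Finset.sum_apply]
    push_cast
    refine Finset.sum_congr rfl fun k _ => ?_
    simp only [Pi.smul_apply, smul_eq_mul]
    ring
  rw [key]
  refine Submodule.sum_mem _ fun k hk => Submodule.smul_mem _ _ ?_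
  refine Submodule.span_mono (image_mono ?_) (sin_pow_mem_span_exp (by positivity) k)
  have : (k : ℝ) * (N : ℝ)⁻¹ ≤ 1 := by
    rw [← div_eq_mul_inv, div_le_one hN']
    have := Finset.mem_range.mp hk
    exact_mod_cast (show k ≤ N by omega)
  exact Icc_subset_Icc (by linarith) this

open Polynomial in
/-- The operator conjugate to the second derivative under `t ↦ b sin t`. -/
def sinConj (b : ℝ) (F : ℝ[X]) : ℝ[X] :=
  (C (b ^ 2) - X ^ 2) * derivative (derivative F) - X * derivative F

open Polynomial in
theorem coeff_sinConj (b : ℝ) (F : ℝ[X]) (m : ℕ) :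
    (sinConj b F).coeff m = b ^ 2 * ((m + 1) * (m + 2)) * F.coeff (m + 2) - m ^ 2 * F.coeff m := by
  rw [sinConj, coeff_sub, sub_mul, coeff_sub, coeff_C_mul]
  rcases m with _ | _ | m
  · simp [coeff_derivative]; ring
  · simp [coeff_derivative, coeff_X_pow_mul', coeff_X_mul]; ring
  · rw [coeff_X_pow_mul, coeff_X_mul]
    simp only [coeff_derivative]
    push_cast; ring

theorem deriv_sinPullback (b ω : ℝ) (F : Polynomial ℝ) :
    deriv (sinPullback b ω F) = fun t : ℝ =>
      ((b * ω * Real.cos (t * ω) * F.derivative.eval (b * Real.sin (t * ω)) : ℝ) : ℂ) := by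
  funext t
  have h0 : HasDerivAt (fun t : ℝ => t * ω) ω t := by simpa using (hasDerivAt_id t).mul_const ω
  have h1 := (h0.sin.const_mul b)
  have h2 := ((F.hasDerivAt (b * Real.sin (t * ω))).comp t h1).ofReal_comp
  refine (h2.congr_deriv ?_).deriv
  congr 1; ring

theorem deriv_deriv_sinPullback (b ω : ℝ) (F : Polynomial ℝ) :
    deriv (deriv (sinPullback b ω F)) = ((ω ^ 2 : ℝ) : ℂ) • sinPullback b ω (sinConj b F) := by
  rw [deriv_sinPullback]
  funext t
  have h0 : HasDerivAt (fun t : ℝ => t * ω) ω t := by simpa using (hasDerivAt_id t).mul_const ω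
  have h1 := (h0.sin.const_mul b)
  have h2 := ((h0.cos.const_mul (b * ω)).mul
    ((F.derivative.hasDerivAt (b * Real.sin (t * ω))).comp t h1)).ofReal_comp
  refine (h2.congr_deriv ?_).deriv
  rw [Pi.smul_apply, sinPullback, smul_eq_mul, ← Complex.ofReal_mul]
  congr 1
  simp only [sinConj, Polynomial.eval_sub, Polynomial.eval_mul, Polynomial.eval_C,
    Polynomial.eval_pow, Polynomial.eval_X, Function.comp]
  linear_combination (b ^ 2 * ω ^ 2 *
    (F.derivative.derivative).eval (b * Real.sin (t * ω))) * Real.sin_sq_add_cos_sq (t * ω)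

theorem iteratedDeriv_add_two_sinPullback (b ω : ℝ) (F : Polynomial ℝ) (r : ℕ) (t : ℝ) :
    iteratedDeriv (r + 2) (sinPullback b ω F) t =
      ((ω ^ 2 : ℝ) : ℂ) * iteratedDeriv r (sinPullback b ω (sinConj b F)) t := by
  rw [iteratedDeriv_succ', iteratedDeriv_succ', deriv_deriv_sinPullback]
  exact iteratedDeriv_const_mul_field _ _

theorem abs_coeff_le_sum_iteratedDeriv (b : ℝ) (hb : 0 < b) (m : ℕ) :
    ∃ C : ℝ, 0 ≤ C ∧ ∀ ω ∈ Ioc (0 : ℝ) 1, ∀ F : Polynomial ℝ,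
      ω ^ m * |F.coeff m| ≤
        C * ∑ r ∈ Finset.range (m + 1), ‖iteratedDeriv r (sinPullback b ω F) 0‖ := by
  induction m using Nat.twoStepInduction with
  | zero =>
    refine ⟨1, zero_le_one, fun ω hω F => ?_⟩
    simp [sinPullback, Polynomial.coeff_zero_eq_eval_zero]
  | one =>
    refine ⟨b⁻¹, by positivity, fun ω hω F => ?_⟩
    have : ‖iteratedDeriv 1 (sinPullback b ω F) 0‖ = b * (ω * |F.coeff 1|) := by
      rw [iteratedDeriv_one, deriv_sinPullback, Complex.norm_real]
      have h : F.derivative.eval 0 = F.coeff 1 := by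
        rw [← Polynomial.coeff_zero_eq_eval_zero, Polynomial.coeff_derivative]; simp
      simp [h, abs_of_pos hb, abs_of_pos hω.1, mul_assoc]
    rw [Finset.sum_range_succ, this, mul_add, inv_mul_cancel_left₀ hb.ne', pow_one]
    have : 0 ≤ b⁻¹ * ∑ r ∈ Finset.range 1, ‖iteratedDeriv r (sinPullback b ω F) 0‖ := by positivity
    linarith
  | more m ih _ =>
    obtain ⟨C, hC, h⟩ := ih
    set K : ℝ := b ^ 2 * ((m + 1) * (m + 2)) with hK
    have hK0 : 0 < K := by positivity
    refine ⟨K⁻¹ * (C + m ^ 2 * C), by positivity, fun ω hω F => ?_⟩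
    set S : ℝ := ∑ r ∈ Finset.range (m + 2 + 1), ‖iteratedDeriv r (sinPullback b ω F) 0‖
    have hω2 : ω ^ 2 ≤ 1 := pow_le_one₀ hω.1.le hω.2
    have h1 : ω ^ (m + 2) * |(sinConj b F).coeff m| ≤ C * S := by
      have e := mul_le_mul_of_nonneg_left (h ω hω (sinConj b F)) (sq_nonneg ω)
      calc _ = ω ^ 2 * (ω ^ m * |(sinConj b F).coeff m|) := by ring
        _ ≤ _ := e
        _ = C * ∑ r ∈ Finset.range (m + 1), ‖iteratedDeriv (r + 2) (sinPullback b ω F) 0‖ := by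
          simp only [iteratedDeriv_add_two_sinPullback, norm_mul, Complex.norm_real,
            Real.norm_eq_abs, abs_of_nonneg (sq_nonneg ω), ← Finset.mul_sum]
          ring
        _ ≤ C * S := by
          refine mul_le_mul_of_nonneg_left ?_ hC
          simp only [S]
          rw [Finset.sum_range_succ' _ (m + 2), Finset.sum_range_succ' _ (m + 1)]
          linarith [norm_nonneg (iteratedDeriv 0 (sinPullback b ω F) 0),
            norm_nonneg (iteratedDeriv (0 + 1) (sinPullback b ω F) 0)]
    have h2 : ω ^ (m + 2) * |F.coeff m| ≤ C * S := by
      have e1 : ω ^ (m + 2) * |F.coeff m| ≤ ω ^ m * |F.coeff m| := by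
        rw [pow_add]
        have : 0 ≤ ω ^ m * |F.coeff m| := mul_nonneg (pow_nonneg hω.1.le _) (abs_nonneg _)
        nlinarith
      refine e1.trans ((h ω hω F).trans (mul_le_mul_of_nonneg_left ?_ hC))
      exact Finset.sum_le_sum_of_subset_of_nonneg (Finset.range_mono (by omega))
        fun _ _ _ => norm_nonneg _
    have h3 : K * |F.coeff (m + 2)| ≤ |(sinConj b F).coeff m| + m ^ 2 * |F.coeff m| := by
      have : K * F.coeff (m + 2) = (sinConj b F).coeff m + m ^ 2 * F.coeff m := by
        rw [coeff_sinConj]; ring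
      rw [← abs_of_pos hK0, ← abs_mul, this]
      refine (abs_add_le _ _).trans ?_
      rw [abs_mul, abs_of_nonneg (by positivity : (0 : ℝ) ≤ (m : ℝ) ^ 2)]
    have h4 : 0 ≤ ω ^ (m + 2) := pow_nonneg hω.1.le _
    rw [mul_assoc, le_inv_mul_iff₀ hK0]
    calc K * (ω ^ (m + 2) * |F.coeff (m + 2)|) = ω ^ (m + 2) * (K * |F.coeff (m + 2)|) := by ring
      _ ≤ ω ^ (m + 2) * (|(sinConj b F).coeff m| + m ^ 2 * |F.coeff m|) := by gcongr
      _ = ω ^ (m + 2) * |(sinConj b F).coeff m| + m ^ 2 * (ω ^ (m + 2) * |F.coeff m|) := by ring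
      _ ≤ C * S + m ^ 2 * (C * S) := by gcongr
      _ = _ := by ring

/-- The weight `(1 + |t|)⁻¹` on the line. -/
def lineWeight (t : ℝ) : ℝ≥0∞ := ENNReal.ofReal (1 + |t|)⁻¹

theorem lineWeight_le_one (t : ℝ) : lineWeight t ≤ 1 := by
  rw [lineWeight, ← ENNReal.ofReal_one]
  exact ENNReal.ofReal_le_ofReal (inv_le_one_of_one_le₀ (by linarith [abs_nonneg t]))

@[simp] theorem lineWeight_zero : lineWeight 0 = 1 := by simp [lineWeight]

theorem measurable_lineWeight : Measurable lineWeight := by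
  unfold lineWeight
  fun_prop

theorem lineWeight_mul_le (s t : ℝ) : lineWeight s * lineWeight t ≤ lineWeight (s + t) := by
  have hs := abs_nonneg s
  have ht := abs_nonneg t
  rw [lineWeight, lineWeight, lineWeight, ← ENNReal.ofReal_mul (by positivity), ← mul_inv]
  refine ENNReal.ofReal_le_ofReal (inv_anti₀ (by positivity) ?_)
  nlinarith [abs_add_le s t, mul_nonneg hs ht]

/-- The finite measure `(1 + |t|)⁻² dt` on the line. -/
def lineMeasure : Measure ℝ := volume.withDensity fun t => lineWeight t ^ 2

theorem lintegral_lineMeasure {f : ℝ → ℝ≥0∞} (hf : Measurable f) :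
    ∫⁻ t, f t ∂lineMeasure = ∫⁻ t, f t * lineWeight t ^ 2 := by
  rw [lineMeasure, lintegral_withDensity_eq_lintegral_mul _ (measurable_lineWeight.pow_const 2) hf]
  simp only [Pi.mul_apply, mul_comm]

instance : IsFiniteMeasure lineMeasure := by
  refine isFiniteMeasure_withDensity (ne_of_lt ?_)
  have h := finite_integral_one_add_norm (E := ℝ) (μ := volume) (r := 2) (by norm_num)
  refine lt_of_le_of_lt (le_of_eq (lintegral_congr fun t => ?_)) h
  have := abs_nonneg t
  rw [lineWeight, ← ENNReal.ofReal_pow (by positivity), Real.norm_eq_abs,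
    Real.rpow_neg (by positivity), inv_pow]
  norm_num

open scoped SchwartzMap in
theorem schwartz_enorm_le_lineWeight (ψ : 𝓢(ℝ, ℂ)) (M : ℕ) :
    ∃ C : ℝ≥0∞, C ≠ ∞ ∧ ∀ t, ‖ψ t‖ₑ ≤ C * lineWeight t ^ M := by
  have h := fun t => SchwartzMap.one_add_le_sup_seminorm_apply (𝕜 := ℝ) (m := (M, 0))
    (le_refl M) (le_refl 0) ψ t
  simp only [norm_iteratedFDeriv_zero] at h
  set K := (2 : ℝ) ^ (M, 0).1 * ((Finset.Iic (M, 0)).sup fun m => SchwartzMap.seminorm ℝ m.1 m.2) ψ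
  refine ⟨ENNReal.ofReal K, ENNReal.ofReal_ne_top, fun t => ?_⟩
  have ht := abs_nonneg t
  have hp : 0 < (1 + |t|) ^ M := by positivity
  have hK : 0 ≤ K := le_trans (by positivity) (h t)
  rw [lineWeight, ← ENNReal.ofReal_pow (by positivity), ← ENNReal.ofReal_mul hK,
    ← ofReal_norm]
  refine ENNReal.ofReal_le_ofReal ?_
  rw [inv_pow, ← div_eq_mul_inv, le_div_iff₀ hp, mul_comm]
  exact h t

theorem exists_enorm_iteratedDeriv_le_lintegral (r M : ℕ) :
    ∃ C : ℝ≥0∞, C ≠ ∞ ∧ ∀ U ∈ bandLimited, ∀ τ,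
      ‖iteratedDeriv r U τ‖ₑ * lineWeight τ ^ M ≤ C * ∫⁻ t, ‖U t‖ₑ * lineWeight t ^ M := by
  obtain ⟨ψ, hψ⟩ := exists_schwartz_multiplier r
  obtain ⟨C, hC, h⟩ := schwartz_enorm_le_lineWeight ψ M
  refine ⟨C, hC, fun U hU τ => ?_⟩
  rw [iteratedDeriv_eq_integral_of_mem_bandLimited hψ hU]
  have hw : lineWeight τ ^ M ≠ ∞ :=
    ENNReal.pow_ne_top (ne_top_of_le_ne_top ENNReal.one_ne_top (lineWeight_le_one τ))
  calc _ ≤ (∫⁻ t, ‖U (τ + t) * ψ t‖ₑ) * lineWeight τ ^ M := by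
        gcongr; exact enorm_integral_le_lintegral_enorm _
    _ = ∫⁻ t, ‖U (τ + t) * ψ t‖ₑ * lineWeight τ ^ M := (lintegral_mul_const' _ _ hw).symm
    _ ≤ ∫⁻ t, C * (‖U (τ + t)‖ₑ * lineWeight (τ + t) ^ M) := by
        refine lintegral_mono fun t => ?_
        rw [enorm_mul]
        calc ‖U (τ + t)‖ₑ * ‖ψ t‖ₑ * lineWeight τ ^ M
            ≤ ‖U (τ + t)‖ₑ * (C * lineWeight t ^ M) * lineWeight τ ^ M := by gcongr; exact h t
          _ = C * (‖U (τ + t)‖ₑ * (lineWeight τ * lineWeight t) ^ M) := by rw [mul_pow]; ring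
          _ ≤ _ := by gcongr; exact lineWeight_mul_le τ t
    _ = C * ∫⁻ t, ‖U (τ + t)‖ₑ * lineWeight (τ + t) ^ M := lintegral_const_mul' _ _ hC
    _ = _ := by rw [lintegral_add_left_eq_self (fun t => ‖U t‖ₑ * lineWeight t ^ M) τ]

theorem exists_enorm_iteratedDeriv_le_lineMeasure_of_le_one (r : ℕ) {p : ℝ} (hp : 0 < p)
    (hp1 : p ≤ 1) :
    ∃ C : ℝ≥0∞, C ≠ ∞ ∧ ∀ U ∈ bandLimited,
      ‖iteratedDeriv r U 0‖ₑ ≤ C * (∫⁻ t, ‖U t‖ₑ ^ p ∂lineMeasure) ^ (1 / p) := by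
  set M : ℕ := ⌈2 / p⌉₊
  have hM : 2 ≤ M * p := by
    have := Nat.le_ceil (2 / p)
    rwa [div_le_iff₀ hp] at this
  obtain ⟨C₀, hC₀, h₀⟩ := exists_enorm_iteratedDeriv_le_lintegral 0 M
  obtain ⟨C, hC, h⟩ := exists_enorm_iteratedDeriv_le_lintegral r M
  have hq : 0 ≤ (1 - p) / p := div_nonneg (by linarith) hp.le
  refine ⟨C * C₀ ^ ((1 - p) / p), ENNReal.mul_ne_top hC (ENNReal.rpow_ne_top_of_nonneg hq hC₀),
    fun U hU => ?_⟩
  set J := ∫⁻ t, ‖U t‖ₑ * lineWeight t ^ M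
  set S := ⨆ t, ‖U t‖ₑ * lineWeight t ^ M
  set I := ∫⁻ t, ‖U t‖ₑ ^ p ∂lineMeasure
  have hUm : Measurable U := (contDiff_of_mem_bandLimited hU).continuous.measurable
  have hSJ : S ≤ C₀ * J := iSup_le fun t => by simpa using h₀ U hU t
  have hStop : S ≠ ∞ := by
    obtain ⟨B, hB⟩ := exists_norm_le_of_mem_bandLimited hU
    refine ne_top_of_le_ne_top (b := ENNReal.ofReal B) ENNReal.ofReal_ne_top (iSup_le fun t => ?_)
    calc _ ≤ ‖U t‖ₑ * 1 := by gcongr; exact pow_le_one' (lineWeight_le_one t) M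
      _ ≤ _ := by
        rw [mul_one, ← ofReal_norm]
        exact ENNReal.ofReal_le_ofReal (hB t)
  have hI : ∫⁻ t, (‖U t‖ₑ * lineWeight t ^ M) ^ p ≤ I := by
    rw [show I = _ from lintegral_lineMeasure (hUm.enorm.pow_const p)]
    refine lintegral_mono fun t => ?_
    rw [ENNReal.mul_rpow_of_nonneg _ _ hp.le, ← ENNReal.rpow_natCast, ← ENNReal.rpow_mul,
      ← ENNReal.rpow_natCast]
    refine mul_le_mul_right ?_ _
    exact ENNReal.rpow_le_rpow_of_exponent_ge (lineWeight_le_one t) (by exact_mod_cast hM)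
  have hJ : J ≤ S ^ (1 - p) * I := by
    refine le_trans ?_ (mul_le_mul_right hI _)
    rw [← lintegral_const_mul' _ _ (ENNReal.rpow_ne_top_of_nonneg (by linarith) hStop)]
    refine lintegral_mono fun t => ?_
    have hle : ‖U t‖ₑ * lineWeight t ^ M ≤ S := le_iSup (fun t => ‖U t‖ₑ * lineWeight t ^ M) t
    calc ‖U t‖ₑ * lineWeight t ^ M
        = (‖U t‖ₑ * lineWeight t ^ M) ^ (1 - p) * (‖U t‖ₑ * lineWeight t ^ M) ^ p := by
          rw [← ENNReal.rpow_add_of_nonneg _ _ (by linarith) hp.le]; simp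
      _ ≤ _ := by gcongr
  have hSp : S ^ p ≤ C₀ * I := by
    rcases eq_or_ne S 0 with h0 | h0
    · rw [h0, ENNReal.zero_rpow_of_pos hp]; exact zero_le
    have h1 : S ^ p * S ^ (1 - p) ≤ C₀ * I * S ^ (1 - p) := by
      rw [← ENNReal.rpow_add _ _ h0 hStop]
      simp only [add_sub_cancel, ENNReal.rpow_one]
      calc S ≤ C₀ * J := hSJ
        _ ≤ C₀ * (S ^ (1 - p) * I) := by gcongr
        _ = _ := by ring
    exact (ENNReal.mul_le_mul_iff_left (ENNReal.rpow_pos (pos_iff_ne_zero.mpr h0) hStop).ne'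
      (ENNReal.rpow_ne_top_of_nonneg (by linarith) hStop)).mp h1
  have hS1 : S ^ (1 - p) ≤ (C₀ * I) ^ ((1 - p) / p) := by
    have := ENNReal.rpow_le_rpow hSp hq
    rwa [← ENNReal.rpow_mul, mul_div_cancel₀ _ hp.ne'] at this
  have hfin : C₀ ^ ((1 - p) / p) * I ^ (1 / p) = (C₀ * I) ^ ((1 - p) / p) * I := by
    rw [ENNReal.mul_rpow_of_nonneg _ _ hq, mul_assoc]
    congr 1
    nth_rw 3 [← ENNReal.rpow_one I]
    rw [← ENNReal.rpow_add_of_nonneg _ _ hq zero_le_one]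
    congr 1
    field_simp; ring
  calc ‖iteratedDeriv r U 0‖ₑ ≤ C * J := by simpa using h U hU 0
    _ ≤ C * ((C₀ * I) ^ ((1 - p) / p) * I) := by gcongr; exact hJ.trans (by gcongr)
    _ = _ := by rw [← hfin, mul_assoc]

theorem exists_enorm_iteratedDeriv_le_lineMeasure (r : ℕ) {p : ℝ} (hp : 0 < p) :
    ∃ C : ℝ≥0∞, C ≠ ∞ ∧ ∀ U ∈ bandLimited,
      ‖iteratedDeriv r U 0‖ₑ ≤ C * (∫⁻ t, ‖U t‖ₑ ^ p ∂lineMeasure) ^ (1 / p) := by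
  rcases le_total p 1 with h1 | h1
  · exact exists_enorm_iteratedDeriv_le_lineMeasure_of_le_one r hp h1
  obtain ⟨C, hC, h⟩ := exists_enorm_iteratedDeriv_le_lineMeasure_of_le_one r zero_lt_one le_rfl
  refine ⟨C * lineMeasure univ ^ (1 / 1 - 1 / p), ENNReal.mul_ne_top hC
    (ENNReal.rpow_ne_top_of_nonneg ?_ (measure_ne_top _ _)), fun U hU => ?_⟩
  · rw [sub_nonneg]; exact one_div_le_one_div_of_le one_pos h1
  have hUm := (contDiff_of_mem_bandLimited hU).continuous.aestronglyMeasurable (μ := lineMeasure)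
  have := eLpNorm'_le_eLpNorm'_mul_rpow_measure_univ zero_lt_one h1 hUm
  rw [eLpNorm', eLpNorm'] at this
  exact (h U hU).trans ((mul_le_mul_right this C).trans_eq (by ring))

/-- Bernstein-type estimate for the Taylor coefficients at `0` of a polynomial on `[-b, b]`. -/
theorem exists_enorm_coeff_le_lineMeasure (m : ℕ) {b p : ℝ} (hb : 0 < b) (hp : 0 < p) :
    ∃ C : ℝ≥0∞, C ≠ ∞ ∧ ∀ N : ℕ, 0 < N → ∀ F : Polynomial ℝ, F.natDegree ≤ N →
      ‖F.coeff m‖ₑ ≤ C * (N : ℝ≥0∞) ^ m *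
        (∫⁻ t, ‖F.eval (b * Real.sin (t * (N : ℝ)⁻¹))‖ₑ ^ p ∂lineMeasure) ^ (1 / p) := by
  obtain ⟨K, hK, h⟩ := abs_coeff_le_sum_iteratedDeriv b hb m
  choose C hC hCU using fun r => exists_enorm_iteratedDeriv_le_lineMeasure r hp
  refine ⟨ENNReal.ofReal K * ∑ r ∈ Finset.range (m + 1), C r, ENNReal.mul_ne_top
    ENNReal.ofReal_ne_top (ENNReal.sum_ne_top.mpr fun r _ => hC r), fun N hN F hF => ?_⟩
  have hN' : (0 : ℝ) < N := by exact_mod_cast hN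
  have hU := sinPullback_mem_bandLimited hN b hF
  set Ψ := ∫⁻ t, ‖F.eval (b * Real.sin (t * (N : ℝ)⁻¹))‖ₑ ^ p ∂lineMeasure
  have hΨ : ∫⁻ t, ‖sinPullback b (N : ℝ)⁻¹ F t‖ₑ ^ p ∂lineMeasure = Ψ := by
    refine lintegral_congr fun t => ?_
    rw [sinPullback, ← ofReal_norm, Complex.norm_real, ofReal_norm]
  have h1 := h (N : ℝ)⁻¹ ⟨by positivity, inv_le_one_of_one_le₀ (by exact_mod_cast hN)⟩ F
  have h2 : |F.coeff m| ≤ (N : ℝ) ^ m *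
      (K * ∑ r ∈ Finset.range (m + 1), ‖iteratedDeriv r (sinPullback b (N : ℝ)⁻¹ F) 0‖) := by
    rwa [inv_pow, inv_mul_le_iff₀ (by positivity)] at h1
  rw [← ofReal_norm, Real.norm_eq_abs]
  refine (ENNReal.ofReal_le_ofReal h2).trans ?_
  rw [ENNReal.ofReal_mul (by positivity), ENNReal.ofReal_mul hK,
    ENNReal.ofReal_sum_of_nonneg (fun _ _ => norm_nonneg _), ENNReal.ofReal_pow (by positivity),
    ENNReal.ofReal_natCast]
  calc _ ≤ (N : ℝ≥0∞) ^ m * (ENNReal.ofReal K *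
        ∑ r ∈ Finset.range (m + 1), C r * Ψ ^ (1 / p)) := by
        gcongr with r _
        rw [ofReal_norm, ← hΨ]
        exact hCU r _ hU
    _ = _ := by rw [← Finset.sum_mul]; ring

/-- The restriction of a bivariate polynomial to the parabola
`s ↦ (q.1 + s, q.2 + c s - β s²)`. -/
def parabolaMap (q : ℝ × ℝ) (c β : ℝ) : MvPolynomial (Fin 2) ℝ →ₐ[ℝ] Polynomial ℝ :=
  MvPolynomial.aeval ![Polynomial.C q.1 + Polynomial.X,
    Polynomial.C q.2 + Polynomial.C c * Polynomial.X - Polynomial.C β * Polynomial.X ^ 2]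

theorem eval_parabolaMap (q : ℝ × ℝ) (c β : ℝ) (P : MvPolynomial (Fin 2) ℝ) (s : ℝ) :
    (parabolaMap q c β P).eval s = evalAt (q.1 + s, q.2 + c * s - β * s ^ 2) P := by
  induction P using MvPolynomial.induction_on with
  | C c => simp [parabolaMap, evalAt]
  | add P Q hP hQ => simp_all [evalAt]
  | mul_X P i hP =>
    rw [map_mul, Polynomial.eval_mul, hP]
    fin_cases i <;> simp [parabolaMap, evalAt]

theorem natDegree_parabolaMap_le (q : ℝ × ℝ) (c β : ℝ) (P : MvPolynomial (Fin 2) ℝ) :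
    (parabolaMap q c β P).natDegree ≤ 2 * P.totalDegree := by
  have h0 : (Polynomial.C q.1 + Polynomial.X).natDegree ≤ 2 := by compute_degree!
  have h1 : (Polynomial.C q.2 + Polynomial.C c * Polynomial.X -
      Polynomial.C β * Polynomial.X ^ 2).natDegree ≤ 2 := by compute_degree
  have h : ∀ i : Fin 2, ((![Polynomial.C q.1 + Polynomial.X,
      Polynomial.C q.2 + Polynomial.C c * Polynomial.X - Polynomial.C β * Polynomial.X ^ 2] :
      Fin 2 → Polynomial ℝ) i).natDegree ≤ 2 := by
    intro i
    fin_cases i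
    · exact h0
    · exact h1
  have := MvPolynomial.aeval_natDegree_le (m := P.totalDegree) (n := 2) P le_rfl _ h
  refine le_trans this (le_of_eq ?_)
  rw [mul_comm]

/-- The double-indexed Taylor coefficients of order `m` along the parabolas
`s ↦ q + s (1, d + z v - β s)`. -/
def parabolaCoeff (q : ℝ × ℝ) (d v : ℝ) (P : MvPolynomial (Fin 2) ℝ) (m e k : ℕ) : ℝ :=
  (-1) ^ e * v ^ k / (e.factorial * k.factorial) *
    if 2 * e + k ≤ m then evalAt q ((dirDeriv 1 d ^ (m - (2 * e + k)))
      ((dirDeriv 0 1 ^ (k + e)) P)) / (m - (2 * e + k)).factorial else 0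

theorem coeff_parabolaMap (q : ℝ × ℝ) (d v z β : ℝ) (P : MvPolynomial (Fin 2) ℝ) (m : ℕ) :
    (parabolaMap q (d + z * v) β P).coeff m = ∑ e ∈ Finset.range (m + 1),
      (∑ k ∈ Finset.range (m + 1), parabolaCoeff q d v P m e k * z ^ k) * β ^ e := by
  set R := P.totalDegree + m + 1 with hR
  have hP : ∀ j, ((dirDeriv 0 1 ^ j) P).totalDegree < R := fun j =>
    (totalDegree_dirDeriv_pow_le 0 1 j P).trans_lt (by omega)
  have key : parabolaMap q (d + z * v) β P = ∑ e ∈ Finset.range R, ∑ k ∈ Finset.range R,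
      ∑ l ∈ Finset.range R, Polynomial.C ((-1) ^ e * v ^ k / (e.factorial * k.factorial) *
        (evalAt q ((dirDeriv 1 d ^ l) ((dirDeriv 0 1 ^ (k + e)) P)) / l.factorial) *
          z ^ k * β ^ e) * Polynomial.X ^ (2 * e + k + l) := by
    refine Polynomial.funext fun s => ?_
    rw [eval_parabolaMap]
    have h1 := evalAt_line P (R := R) (by omega) (q.1 + s) (q.2 + s * d + z * v * s) 0 1 (-β * s ^ 2)
    rw [show (q.1 + s, q.2 + (d + z * v) * s - β * s ^ 2) = ((q.1 + s) + -β * s ^ 2 * 0,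
      (q.2 + s * d + z * v * s) + -β * s ^ 2 * 1) by ext <;> simp; ring, h1,
      Polynomial.eval_finsetSum]
    refine Finset.sum_congr rfl fun e _ => ?_
    have h2 := evalAt_line ((dirDeriv 0 1 ^ e) P) (hP e) (q.1 + s) (q.2 + s * d) 0 1 (z * v * s)
    rw [show (q.1 + s, q.2 + s * d + z * v * s) = ((q.1 + s) + z * v * s * 0,
      (q.2 + s * d) + z * v * s * 1) by ext <;> simp, h2, Polynomial.eval_finsetSum,
      Finset.sum_div, Finset.sum_mul]
    refine Finset.sum_congr rfl fun k _ => ?_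
    rw [← Module.End.mul_apply (dirDeriv 0 1 ^ k), ← pow_add]
    have h3 := evalAt_line ((dirDeriv 0 1 ^ (k + e)) P) (hP _) q.1 q.2 1 d s
    rw [mul_one] at h3
    rw [h3, Polynomial.eval_finsetSum, Finset.sum_div, Finset.sum_mul, Finset.sum_div,
      Finset.sum_mul]
    refine Finset.sum_congr rfl fun l _ => ?_
    simp only [Polynomial.eval_mul, Polynomial.eval_C, Polynomial.eval_pow, Polynomial.eval_X]
    have e1 : (-β * s ^ 2) ^ e = (-1) ^ e * β ^ e * s ^ (2 * e) := by
      rw [mul_pow, ← pow_mul, neg_pow]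
    have e2 : s ^ (2 * e + k + l) = s ^ (2 * e) * s ^ k * s ^ l := by rw [pow_add, pow_add]
    rw [e1, e2, mul_pow, mul_pow]
    ring
  have hinner : ∀ e k, (∑ l ∈ Finset.range R, (Polynomial.C ((-1) ^ e * v ^ k /
      (e.factorial * k.factorial) *
        (evalAt q ((dirDeriv 1 d ^ l) ((dirDeriv 0 1 ^ (k + e)) P)) / l.factorial) *
          z ^ k * β ^ e) * Polynomial.X ^ (2 * e + k + l)).coeff m) =
      parabolaCoeff q d v P m e k * z ^ k * β ^ e := by
    intro e k
    simp only [Polynomial.coeff_C_mul, Polynomial.coeff_X_pow]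
    rw [parabolaCoeff]
    split_ifs with h
    · rw [Finset.sum_eq_single (m - (2 * e + k))]
      · rw [if_pos (by omega), mul_one]
      · intro l _ hl
        rw [if_neg (by omega), mul_zero]
      · intro h'
        exact absurd (Finset.mem_range.mpr (by omega)) h'
    · simp only [mul_zero, zero_mul]
      refine Finset.sum_eq_zero fun l _ => ?_
      rw [if_neg (by omega), mul_zero]
  have hzero : ∀ e k, m < e ∨ m < k → parabolaCoeff q d v P m e k = 0 := by
    intro e k h
    rw [parabolaCoeff, if_neg (by omega), mul_zero]
  have hsub : Finset.range (m + 1) ⊆ Finset.range R := Finset.range_mono (by omega)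
  rw [key]
  simp only [Polynomial.finsetSum_coeff, hinner, Finset.sum_mul]
  rw [← Finset.sum_subset hsub fun e _ he => Finset.sum_eq_zero fun k _ => by
    rw [hzero e k (Or.inl (by simpa using he)), zero_mul, zero_mul]]
  refine Finset.sum_congr rfl fun e _ => ?_
  rw [← Finset.sum_subset hsub fun k _ hk => by
    rw [hzero e k (Or.inr (by simpa using hk)), zero_mul, zero_mul]]

/-- The average of `|P|^p` over parabolas through `q` with approximate direction `(1, d)`. -/
def parabolaMean (p b B : ℝ) (N : ℕ) (Θ : ℝ × ℝ → ℝ≥0∞) (q : ℝ × ℝ) (d v : ℝ) : ℝ≥0∞ :=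
  ∫⁻ β in Icc B (B + 1), ∫⁻ t, (∫⁻ z in Icc (1 : ℝ) 2,
    Θ (q.1 + b * Real.sin (t * (N : ℝ)⁻¹), q.2 + (d + z * v) * (b * Real.sin (t * (N : ℝ)⁻¹)) -
      β * (b * Real.sin (t * (N : ℝ)⁻¹)) ^ 2) ^ p) ∂lineMeasure

theorem continuous_evalAt (P : MvPolynomial (Fin 2) ℝ) : Continuous fun q => evalAt q P := by
  induction P using MvPolynomial.induction_on with
  | C c => simpa [evalAt] using continuous_const
  | add P Q hP hQ => 
    simp only [evalAt, map_add] at hP hQ ⊢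
    exact hP.add hQ
  | mul_X P i hP =>
    simp only [evalAt, map_mul, MvPolynomial.eval_X] at hP ⊢
    refine hP.mul ?_
    fin_cases i
    · exact continuous_fst
    · exact continuous_snd

theorem exists_enorm_evalAt_dirDeriv_le_parabolaMean (l k e : ℕ) {b p : ℝ} (B : ℝ) (hb : 0 < b)
    (hp : 0 < p) {κ : ℕ} (hκ : 2 ≤ κ) :
    ∃ C : ℝ≥0∞, C ≠ ∞ ∧ ∀ n : ℕ, 0 < n → ∀ P : MvPolynomial (Fin 2) ℝ, P.totalDegree ≤ n →
      ∀ (q : ℝ × ℝ) (d v : ℝ),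
      ‖v ^ k * evalAt q ((dirDeriv 1 d ^ l) ((dirDeriv 0 1 ^ (k + e)) P))‖ₑ ≤
        C * (n : ℝ≥0∞) ^ (l + k + 2 * e) *
          (parabolaMean p b B (κ * n) (fun x => ‖evalAt x P‖ₑ) q d v) ^ (1 / p) := by
  set m := l + k + 2 * e with hm
  obtain ⟨C₁, hC₁, h₁⟩ := exists_enorm_coeff_le_lineMeasure m hb hp
  obtain ⟨C₂, hC₂, h₂⟩ := enorm_coeff_rpow_le_lintegral m 1 hp
  obtain ⟨C₃, hC₃, h₃⟩ := enorm_coeff_rpow_le_lintegral m B hp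
  have hp' : 0 ≤ 1 / p := by positivity
  set K : ℝ := e.factorial * k.factorial * l.factorial
  refine ⟨ENNReal.ofReal K * ((C₃ * C₂) ^ (1 / p) * (C₁ * (κ : ℝ≥0∞) ^ m)), ?_,
    fun n hn P hP q d v => ?_⟩
  · exact ENNReal.mul_ne_top ENNReal.ofReal_ne_top (ENNReal.mul_ne_top
      (ENNReal.rpow_ne_top_of_nonneg hp' (ENNReal.mul_ne_top hC₃ hC₂))
      (ENNReal.mul_ne_top hC₁ (ENNReal.pow_ne_top (ENNReal.natCast_ne_top κ))))
  set A := parabolaCoeff q d v P m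
  set W : ℝ≥0∞ := C₁ * (κ * n : ℕ) ^ m
  have hW : W ≠ ∞ := ENNReal.mul_ne_top hC₁ (ENNReal.pow_ne_top (ENNReal.natCast_ne_top _))
  have hcoeff : ∀ z β, ‖(parabolaMap q (d + z * v) β P).coeff m‖ₑ ^ p ≤ W ^ p *
      ∫⁻ t, ‖evalAt (q.1 + b * Real.sin (t * ((κ * n : ℕ) : ℝ)⁻¹),
        q.2 + (d + z * v) * (b * Real.sin (t * ((κ * n : ℕ) : ℝ)⁻¹)) -
        β * (b * Real.sin (t * ((κ * n : ℕ) : ℝ)⁻¹)) ^ 2) P‖ₑ ^ p ∂lineMeasure := by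
    intro z β
    have := h₁ (κ * n) (by positivity) (parabolaMap q (d + z * v) β P)
      ((natDegree_parabolaMap_le _ _ _ _).trans (Nat.mul_le_mul hκ hP))
    have := ENNReal.rpow_le_rpow this hp.le
    rw [ENNReal.mul_rpow_of_nonneg _ _ hp.le, ← ENNReal.rpow_mul, one_div_mul_cancel hp.ne',
      ENNReal.rpow_one] at this
    simpa only [eval_parabolaMap] using this
  have he : e ∈ Finset.range (m + 1) := Finset.mem_range.mpr (by omega)
  have hk : k ∈ Finset.range (m + 1) := Finset.mem_range.mpr (by omega)
  have hA : ‖A e k‖ₑ ^ p ≤ C₃ * C₂ * W ^ p *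
      parabolaMean p b B (κ * n) (fun x => ‖evalAt x P‖ₑ) q d v := by
    have hWp : W ^ p ≠ ∞ := ENNReal.rpow_ne_top_of_nonneg hp.le hW
    have hz : ∀ β : ℝ, ∫⁻ z in Icc (1 : ℝ) 2, ‖∑ k ∈ Finset.range (m + 1),
        (∑ e ∈ Finset.range (m + 1), A e k * β ^ e) * z ^ k‖ₑ ^ p ≤
        W ^ p * ∫⁻ t, (∫⁻ z in Icc (1 : ℝ) 2,
          ‖evalAt (q.1 + b * Real.sin (t * ((κ * n : ℕ) : ℝ)⁻¹),
            q.2 + (d + z * v) * (b * Real.sin (t * ((κ * n : ℕ) : ℝ)⁻¹)) -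
            β * (b * Real.sin (t * ((κ * n : ℕ) : ℝ)⁻¹)) ^ 2) P‖ₑ ^ p) ∂lineMeasure := by
      intro β
      rw [lintegral_lintegral_swap, ← lintegral_const_mul' _ _ hWp]
      · refine lintegral_mono fun z => ?_
        refine le_trans (le_of_eq ?_) (hcoeff z β)
        rw [coeff_parabolaMap]
        congr 2
        simp only [Finset.sum_mul]
        rw [Finset.sum_comm]
        refine Finset.sum_congr rfl fun _ _ => Finset.sum_congr rfl fun _ _ => ?_
        ring
      · refine Measurable.aemeasurable ?_
        refine Measurable.pow_const (Measurable.enorm ?_) p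
        refine Continuous.measurable ((continuous_evalAt P).comp ?_)
        fun_prop
    calc ‖A e k‖ₑ ^ p
        ≤ C₃ * ∫⁻ β in Icc B (B + 1), ‖∑ e ∈ Finset.range (m + 1), A e k * β ^ e‖ₑ ^ p :=
          h₃ (fun e => A e k) e he
      _ ≤ C₃ * ∫⁻ β in Icc B (B + 1), C₂ * (W ^ p * ∫⁻ t, (∫⁻ z in Icc (1 : ℝ) 2,
          ‖evalAt (q.1 + b * Real.sin (t * ((κ * n : ℕ) : ℝ)⁻¹),
            q.2 + (d + z * v) * (b * Real.sin (t * ((κ * n : ℕ) : ℝ)⁻¹)) -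
            β * (b * Real.sin (t * ((κ * n : ℕ) : ℝ)⁻¹)) ^ 2) P‖ₑ ^ p) ∂lineMeasure) := by
          gcongr with β
          refine (h₂ (fun k => ∑ e ∈ Finset.range (m + 1), A e k * β ^ e) k hk).trans ?_
          rw [show (1 : ℝ) + 1 = 2 by norm_num]
          gcongr
          exact hz β
      _ = _ := by
          rw [lintegral_const_mul' _ _ hC₂, lintegral_const_mul' _ _ hWp]
          simp only [parabolaMean, mul_assoc]
  have hA' : ‖A e k‖ₑ ≤ (C₃ * C₂) ^ (1 / p) * W *
      (parabolaMean p b B (κ * n) (fun x => ‖evalAt x P‖ₑ) q d v) ^ (1 / p) := by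
    have := ENNReal.rpow_le_rpow hA hp'
    rwa [← ENNReal.rpow_mul, mul_one_div_cancel hp.ne', ENNReal.rpow_one,
      ENNReal.mul_rpow_of_nonneg _ _ hp', ENNReal.mul_rpow_of_nonneg _ _ hp', ← ENNReal.rpow_mul,
      mul_one_div_cancel hp.ne', ENNReal.rpow_one] at this
  have hval : ‖v ^ k * evalAt q ((dirDeriv 1 d ^ l) ((dirDeriv 0 1 ^ (k + e)) P))‖ₑ =
      ENNReal.ofReal K * ‖A e k‖ₑ := by
    have h1 : A e k = (-1) ^ e * v ^ k / (e.factorial * k.factorial) *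
        (evalAt q ((dirDeriv 1 d ^ l) ((dirDeriv 0 1 ^ (k + e)) P)) / l.factorial) := by
      simp only [A, parabolaCoeff]
      rw [if_pos (by omega), show m - (2 * e + k) = l by omega]
    have hK : 0 < K := by positivity
    rw [← ofReal_norm, ← ofReal_norm, ← ENNReal.ofReal_mul hK.le, h1]
    congr 1
    simp only [Real.norm_eq_abs, abs_mul, abs_div, abs_pow, abs_neg, abs_one, one_pow, K,
      Nat.abs_cast]
    field_simp
  rw [hval]
  refine (mul_le_mul_right hA' _).trans_eq ?_
  push_cast [W]
  rw [mul_pow]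
  ring

theorem setLIntegral_lintegral_shear_le {Φ : ℝ × ℝ → ℝ≥0∞} (hΦ : Measurable Φ) {g d : ℝ → ℝ}
    (hg : Measurable g) (hd : Measurable d) (β s : ℝ) :
    ∫⁻ q in {q : ℝ × ℝ | q.2 < g q.1}, ∫⁻ z in Icc (1 : ℝ) 2,
      Φ (q.1 + s, q.2 + (d q.1 + z * √(g q.1 - q.2)) * s - β * s ^ 2) ≤ 4 * ∫⁻ q, Φ q := by
  have hA : MeasurableSet {q : ℝ × ℝ | q.2 < g q.1} :=
    measurableSet_lt measurable_snd (hg.comp measurable_fst)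
  rcases eq_or_ne s 0 with rfl | hs
  · simp only [add_zero, mul_zero, ne_eq, OfNat.ofNat_ne_zero, not_false_eq_true, zero_pow,
      sub_zero, lintegral_const, MeasurableSet.univ, Measure.restrict_apply, univ_inter,
      Real.volume_Icc]
    norm_num
    calc _ ≤ ∫⁻ q, Φ q := lintegral_mono' Measure.restrict_le_self le_rfl
      _ ≤ _ := le_mul_of_one_le_left (zero_le) (by norm_num)
  have hmeas : Measurable fun q : ℝ × ℝ => ∫⁻ z in Icc (1 : ℝ) 2,
      Φ (q.1 + s, q.2 + (d q.1 + z * √(g q.1 - q.2)) * s - β * s ^ 2) := by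
    refine Measurable.lintegral_prod_right' (f := fun w : (ℝ × ℝ) × ℝ => Φ (w.1.1 + s,
      w.1.2 + (d w.1.1 + w.2 * √(g w.1.1 - w.1.2)) * s - β * s ^ 2)) (hΦ.comp ?_)
    fun_prop
  rw [← lintegral_indicator hA, Measure.volume_eq_prod,
    lintegral_prod _ (hmeas.indicator hA).aemeasurable, lintegral_prod _ hΦ.aemeasurable]
  have hin : ∀ x, ∫⁻ y, {q : ℝ × ℝ | q.2 < g q.1}.indicator (fun q => ∫⁻ z in Icc (1 : ℝ) 2,
      Φ (q.1 + s, q.2 + (d q.1 + z * √(g q.1 - q.2)) * s - β * s ^ 2)) (x, y) ≤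
      4 * ∫⁻ y, Φ (x + s, y) := by
    intro x
    have h := lintegral_lintegral_add_mul_sqrt_le (Φ := fun y => Φ (x + s, y))
      (hΦ.comp (by fun_prop)) (g x) (d x * s - β * s ^ 2) hs
    rw [← lintegral_indicator measurableSet_Iio] at h
    refine le_trans (le_of_eq (lintegral_congr fun y => ?_)) h
    by_cases hy : y < g x
    · rw [indicator_of_mem (show (x, y) ∈ {q : ℝ × ℝ | q.2 < g q.1} from hy),
        indicator_of_mem (show y ∈ Iio (g x) from hy)]
      refine lintegral_congr fun z => ?_
      congr 2
      ring
    · rw [indicator_of_notMem (show (x, y) ∉ {q : ℝ × ℝ | q.2 < g q.1} from hy),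
        indicator_of_notMem (show y ∉ Iio (g x) from hy)]
  calc _ ≤ ∫⁻ x, 4 * ∫⁻ y, Φ (x + s, y) := lintegral_mono hin
    _ = 4 * ∫⁻ x, ∫⁻ y, Φ (x + s, y) := lintegral_const_mul' _ _ (by norm_num)
    _ = _ := by rw [lintegral_add_right_eq_self (fun x => ∫⁻ y, Φ (x, y)) s]

theorem setLIntegral_parabolaMean_le {Θ : ℝ × ℝ → ℝ≥0∞} (hΘ : Measurable Θ) {g d : ℝ → ℝ}
    (hg : Measurable g) (hd : Measurable d) (p b B : ℝ) (N : ℕ) :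
    ∫⁻ q in {q : ℝ × ℝ | q.2 < g q.1}, parabolaMean p b B N Θ q (d q.1) √(g q.1 - q.2) ≤
      4 * lineMeasure univ * ∫⁻ q, Θ q ^ p := by
  set σ : ℝ → ℝ := fun t => b * Real.sin (t * (N : ℝ)⁻¹) with hσ
  have hσm : Measurable σ := by fun_prop
  have hH : Measurable fun w : (((ℝ × ℝ) × ℝ) × ℝ) × ℝ =>
      Θ (w.1.1.1.1 + σ w.1.2, w.1.1.1.2 + (d w.1.1.1.1 + w.2 * √(g w.1.1.1.1 - w.1.1.1.2)) *
        σ w.1.2 - w.1.1.2 * σ w.1.2 ^ 2) ^ p := by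
    refine (hΘ.comp ?_).pow_const p
    fun_prop
  have hz := Measurable.lintegral_prod_right' (ν := volume.restrict (Icc (1 : ℝ) 2)) hH
  have ht := Measurable.lintegral_prod_right' (ν := lineMeasure) hz
  unfold parabolaMean
  rw [lintegral_lintegral_swap ht.aemeasurable]
  calc _ ≤ ∫⁻ β in Icc B (B + 1), ∫⁻ t, 4 * (∫⁻ q, Θ q ^ p) ∂lineMeasure := by
        refine lintegral_mono fun β => ?_
        rw [lintegral_lintegral_swap]
        · refine lintegral_mono fun t => ?_
          exact setLIntegral_lintegral_shear_le (Φ := fun q => Θ q ^ p) (hΘ.pow_const p) hg hd β (σ t)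
        · exact (hz.comp (f := fun w : (ℝ × ℝ) × ℝ => ((w.1, β), w.2)) (by fun_prop)).aemeasurable
    _ = _ := by
        simp only [lintegral_const, Measure.restrict_apply_univ, Real.volume_Icc,
          add_sub_cancel_left, ENNReal.ofReal_one, mul_one]
        ring

theorem ContDiff.exists_deriv_lipschitz_Icc {g : ℝ → ℝ} (hg : ContDiff ℝ 2 g) (K : ℝ) :
    ∃ M : ℝ, 0 ≤ M ∧ ∀ x ∈ Icc (-K) K, ∀ y ∈ Icc (-K) K,
      |deriv g y - deriv g x| ≤ M * |y - x| := by
  have h1 : ContDiff ℝ 1 (deriv g) := hg.iterate_deriv' 1 1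
  have hc : Continuous (deriv (deriv g)) := h1.continuous_deriv le_rfl
  obtain ⟨M, hM⟩ := isCompact_Icc.exists_bound_of_continuousOn (s := Icc (-K) K) hc.continuousOn
  refine ⟨max M 0, le_max_right _ _, fun x hx y hy => ?_⟩
  exact (convex_Icc (-K) K).norm_image_sub_le_of_norm_deriv_le
    (fun z _ => (h1.differentiable one_ne_zero).differentiableAt)
    (fun z hz => (hM z hz).trans (le_max_left _ _)) hx hy

theorem abs_sub_tangent_le {g : ℝ → ℝ} (hg : Differentiable ℝ g) {K M : ℝ} (hM : 0 ≤ M)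
    (h : ∀ x ∈ Icc (-K) K, ∀ y ∈ Icc (-K) K, |deriv g y - deriv g x| ≤ M * |y - x|)
    {x y : ℝ} (hx : x ∈ Icc (-K) K) (hy : y ∈ Icc (-K) K) :
    |g y - g x - deriv g x * (y - x)| ≤ M * (y - x) ^ 2 := by
  have key := (convex_uIcc x y).norm_image_sub_le_of_norm_hasDerivWithin_le
    (f := fun z => g z - deriv g x * z) (f' := fun z => deriv g z - deriv g x)
    (C := M * |y - x|)
    (fun z _ => ((hg z).hasDerivAt.sub (by
      simpa using (hasDerivAt_id z).const_mul (deriv g x))).hasDerivWithinAt)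
    (fun z hz => ?_) left_mem_uIcc right_mem_uIcc
  · rw [Real.norm_eq_abs, Real.norm_eq_abs, mul_assoc, abs_mul_abs_self] at key
    convert key using 2 <;> ring
  · refine (h x hx z (uIcc_subset_Icc hx hy hz)).trans ?_
    exact mul_le_mul_of_nonneg_left (abs_sub_left_of_mem_uIcc hz) hM

/-- Short parabolas with large curvature that start in `G` stay in `G(λ)`. -/
theorem exists_parabola_mem_Gset {a L lam : ℝ} (ha : 0 < a) (hL : 1 ≤ L) (hlam : 1 < lam)
    {g : ℝ → ℝ} (hg : ContDiff ℝ 2 g) :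
    ∃ b B : ℝ, 0 < b ∧ ∀ q ∈ Gset a L g 1, ∀ s, |s| ≤ b → ∀ z ∈ Icc (1 : ℝ) 2,
      ∀ β ∈ Icc B (B + 1), (q.1 + s, q.2 + (deriv g q.1 + z * √(g q.1 - q.2)) * s - β * s ^ 2) ∈
        Gset a L g lam := by
  obtain ⟨M, hM, hLip⟩ := hg.exists_deriv_lipschitz_Icc (lam * a)
  have hLa : 0 < L * a := by positivity
  set D : ℝ := 2 * √(L * a) + 2 * M + 2 with hD
  have hD0 : 0 < D := by positivity
  set b := min (min ((lam - 1) * a) 1) ((lam - 1) * (L * a) / D)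
  have hb1 : b ≤ (lam - 1) * a := (min_le_left _ _).trans (min_le_left _ _)
  have hb2 : b ≤ 1 := (min_le_left _ _).trans (min_le_right _ _)
  have hb3 : D * b ≤ (lam - 1) * (L * a) := by
    have : b ≤ (lam - 1) * (L * a) / D := min_le_right _ _
    rwa [le_div_iff₀ hD0, mul_comm] at this
  have hl : 0 < lam - 1 := by linarith
  have hb : 0 < b := lt_min (lt_min (by positivity) one_pos) (by positivity)
  refine ⟨b, M + 1, hb, fun q hq s hs z hz β hβ => ?_⟩
  obtain ⟨⟨hx1, hx2⟩, hy1, hy2⟩ := hq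
  obtain ⟨hs1, hs2⟩ := abs_le.mp hs
  set v := √(g q.1 - q.2)
  have hv : 0 ≤ v := Real.sqrt_nonneg _
  have hv2 : v ^ 2 = g q.1 - q.2 := Real.sq_sqrt (by linarith)
  have hvL : v ≤ √(L * a) := Real.sqrt_le_sqrt (by linarith)
  have hx : q.1 ∈ Icc (-(lam * a)) (lam * a) := ⟨by nlinarith, by nlinarith⟩
  have hxs : q.1 + s ∈ Ioo (-(lam * a)) (lam * a) := ⟨by nlinarith, by nlinarith⟩
  have hT := abs_le.mp (abs_sub_tangent_le (hg.differentiable two_ne_zero) hM hLip hx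
    (Ioo_subset_Icc_self hxs))
  rw [add_sub_cancel_left] at hT
  have hzv : |z * v * s| ≤ 2 * v * |s| := by
    rw [abs_mul, abs_mul, abs_of_nonneg hv, abs_of_nonneg (by linarith [hz.1] : 0 ≤ z)]
    have := hz.2
    gcongr
  have hzv' := abs_le.mp hzv
  have hss : s ^ 2 = |s| ^ 2 := (sq_abs s).symm
  have hs0 := abs_nonneg s
  refine ⟨hxs, ?_, ?_⟩
  · show g (q.1 + s) - lam * L * a < _
    have h1 : v * |s| ≤ √(L * a) * b := by gcongr
    have h2 : s ^ 2 ≤ b := by nlinarith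
    have h3 : (2 * M + 2) * s ^ 2 ≤ (2 * M + 2) * b := by gcongr
    have h4 : β * s ^ 2 ≤ (M + 2) * s ^ 2 := by
      have := hβ.2
      gcongr; linarith
    have h5 : D * b = 2 * (√(L * a) * b) + (2 * M + 2) * b := by rw [hD]; ring
    nlinarith [hT.2]
  · show q.2 + _ - _ ≤ g (q.1 + s)
    have h4 : (M + 1) * s ^ 2 ≤ β * s ^ 2 := by
      have := hβ.1
      gcongr
    nlinarith [sq_nonneg (v - |s|), hT.1]

theorem exists_enorm_phi_pow_mul_evalAt_le {r i j k : ℕ} (hk : k ≤ r) {b p : ℝ} (B : ℝ)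
    (hb : 0 < b) (hp : 0 < p) :
    ∃ C : ℝ≥0∞, C ≠ ∞ ∧ ∀ n : ℕ, 0 < n → ∀ P : MvPolynomial (Fin 2) ℝ, P.totalDegree ≤ n →
      ∀ (q : ℝ × ℝ) (d v : ℝ), 0 ≤ v →
      ‖(v + 1 / n) ^ (i + k) *
        evalAt q ((dirDeriv 1 d ^ (r - k)) ((dirDeriv 0 1 ^ (k + (i + j))) P))‖ₑ ≤
        C * ((n : ℝ≥0∞) ^ (r + 2 * j + i) *
          (parabolaMean p b B (2 * n) (fun x => ‖evalAt x P‖ₑ) q d v) ^ (1 / p)) := by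
  obtain ⟨C₁, hC₁, h₁⟩ := exists_enorm_evalAt_dirDeriv_le_parabolaMean (r - k) (i + k) j B hb hp
    (le_refl 2)
  obtain ⟨C₂, hC₂, h₂⟩ := exists_enorm_evalAt_dirDeriv_le_parabolaMean (r - k) 0 (i + j + k) B hb hp
    (le_refl 2)
  refine ⟨2 ^ (i + k) * (C₁ + C₂), ENNReal.mul_ne_top (by finiteness)
    (ENNReal.add_ne_top.mpr ⟨hC₁, hC₂⟩), fun n hn P hP q d v hv => ?_⟩
  have hn' : (0 : ℝ) < n := by exact_mod_cast hn
  set Ψ := (parabolaMean p b B (2 * n) (fun x => ‖evalAt x P‖ₑ) q d v) ^ (1 / p)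
  set A := evalAt q ((dirDeriv 1 d ^ (r - k)) ((dirDeriv 0 1 ^ (k + (i + j))) P)) with hA
  have e₁ := h₁ n hn P hP q d v
  have e₂ := h₂ n hn P hP q d v
  rw [show i + k + j = k + (i + j) by ring, ← hA,
    show r - k + (i + k) + 2 * j = r + 2 * j + i by omega] at e₁
  rw [show 0 + (i + j + k) = k + (i + j) by ring, ← hA, pow_zero, one_mul,
    show r - k + 0 + 2 * (i + j + k) = r + 2 * j + i + (i + k) by omega, pow_add] at e₂
  have hphi : (v + 1 / n) ^ (i + k) ≤ 2 ^ (i + k) * (v ^ (i + k) + (1 / (n : ℝ)) ^ (i + k)) := by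
    have h1 : 0 ≤ 1 / (n : ℝ) := by positivity
    calc (v + 1 / n) ^ (i + k) ≤ (2 * max v (1 / n)) ^ (i + k) := by
          gcongr
          linarith [le_max_left v (1 / n), le_max_right v (1 / (n : ℝ))]
      _ = 2 ^ (i + k) * max v (1 / n) ^ (i + k) := mul_pow _ _ _
      _ ≤ _ := by
          gcongr
          rcases max_cases v (1 / (n : ℝ)) with h | h <;> rw [h.1] <;>
            linarith [pow_nonneg hv (i + k), pow_nonneg h1 (i + k)]
  have hinv : ‖(1 / (n : ℝ)) ^ (i + k)‖ₑ * (n : ℝ≥0∞) ^ (i + k) = 1 := by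
    rw [enorm_pow, ← mul_pow, ← ofReal_norm, Real.norm_eq_abs, abs_of_pos (by positivity),
      ← ENNReal.ofReal_natCast, ← ENNReal.ofReal_mul (by positivity), one_div_mul_cancel hn'.ne']
    simp
  calc ‖(v + 1 / n) ^ (i + k) * A‖ₑ
      ≤ ‖(2 ^ (i + k) * (v ^ (i + k) + (1 / (n : ℝ)) ^ (i + k))) * A‖ₑ := by
        rw [enorm_mul, enorm_mul (2 ^ (i + k) * _)]
        gcongr
        rw [enorm_le_iff_norm_le, Real.norm_of_nonneg (by positivity),
          Real.norm_of_nonneg (by positivity)]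
        exact hphi
    _ = 2 ^ (i + k) * ‖v ^ (i + k) * A + (1 / (n : ℝ)) ^ (i + k) * A‖ₑ := by
        rw [mul_assoc, enorm_mul, add_mul, enorm_pow]
        congr 2
        rw [← ofReal_norm]; simp
    _ ≤ 2 ^ (i + k) * (‖v ^ (i + k) * A‖ₑ + ‖(1 / (n : ℝ)) ^ (i + k)‖ₑ * ‖A‖ₑ) := by
        gcongr
        refine (enorm_add_le _ _).trans_eq ?_
        rw [enorm_mul ((1 / (n : ℝ)) ^ (i + k))]
    _ ≤ 2 ^ (i + k) * (C₁ * (n : ℝ≥0∞) ^ (r + 2 * j + i) * Ψ + ‖(1 / (n : ℝ)) ^ (i + k)‖ₑ *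
          (C₂ * ((n : ℝ≥0∞) ^ (r + 2 * j + i) * (n : ℝ≥0∞) ^ (i + k)) * Ψ)) := by gcongr
    _ = 2 ^ (i + k) * (C₁ * (n : ℝ≥0∞) ^ (r + 2 * j + i) * Ψ +
          (‖(1 / (n : ℝ)) ^ (i + k)‖ₑ * (n : ℝ≥0∞) ^ (i + k)) *
          (C₂ * (n : ℝ≥0∞) ^ (r + 2 * j + i) * Ψ)) := by ring
    _ = _ := by rw [hinv]; ring

theorem phi2_nonneg (g : ℝ → ℝ) (n : ℕ) (q : ℝ × ℝ) : 0 ≤ phi2 g n q := by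
  unfold phi2; positivity

/-- The maximal function of `G` near `q` is controlled by derivatives along the fixed tangent
direction `(1, g′(q.1))`. -/
theorem phi2_pow_mul_sSup_le {a M μ : ℝ} {g : ℝ → ℝ} (hM : 0 ≤ M)
    (hLip : ∀ x ∈ Icc (-(2 * a)) (2 * a), ∀ y ∈ Icc (-(2 * a)) (2 * a),
      |deriv g y - deriv g x| ≤ M * |y - x|) (hμ : 1 ≤ μ) (r i m n : ℕ)
    (P : MvPolynomial (Fin 2) ℝ) {q : ℝ × ℝ} (hq : |q.1| ≤ a) :
    phi2 g n q ^ i * sSup {A : ℝ | ∃ t : ℝ, |t| ≤ min (μ * phi2 g n q) a ∧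
        A = |DtanAt g (q.1 + t) r (pd2^[m] (fun q => evalAt q P)) q|} ≤
      μ ^ r * ∑ k ∈ Finset.range (r + 1), (r.choose k * M ^ k) *
        |phi2 g n q ^ (i + k) *
          evalAt q ((dirDeriv 1 (deriv g q.1) ^ (r - k)) ((dirDeriv 0 1 ^ (k + m)) P))| := by
  set φ := phi2 g n q with hφ
  have hφ0 : 0 ≤ φ := phi2_nonneg g n q
  set D : ℕ → ℝ := fun k =>
    evalAt q ((dirDeriv 1 (deriv g q.1) ^ (r - k)) ((dirDeriv 0 1 ^ (k + m)) P)) with hD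
  have hS : sSup {A : ℝ | ∃ t : ℝ, |t| ≤ min (μ * φ) a ∧
      A = |DtanAt g (q.1 + t) r (pd2^[m] (fun q => evalAt q P)) q|} ≤
      ∑ k ∈ Finset.range (r + 1), (r.choose k * (M * (μ * φ)) ^ k) * |D k| := by
    refine Real.sSup_le ?_ (Finset.sum_nonneg fun k _ => by positivity)
    rintro _ ⟨t, ht, rfl⟩
    have ht1 := ht.trans (min_le_left _ _)
    obtain ⟨hq1, hq2⟩ := abs_le.mp hq
    obtain ⟨ht2, ht3⟩ := abs_le.mp (ht.trans (min_le_right _ _))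
    have hd := hLip q.1 ⟨by linarith, by linarith⟩ (q.1 + t) ⟨by linarith, by linarith⟩
    rw [add_sub_cancel_left] at hd
    rw [DtanAt_pd2_evalAt, dirDeriv_slope_pow (deriv g q.1), evalAt, map_sum]
    refine (Finset.abs_sum_le_sum_abs _ _).trans (Finset.sum_le_sum fun k _ => ?_)
    rw [MvPolynomial.smul_eval, ← Module.End.mul_apply (dirDeriv 0 1 ^ k), ← pow_add, abs_mul,
      abs_mul, abs_pow, Nat.abs_cast]
    change _ * |D k| ≤ _
    gcongr
    exact hd.trans (by gcongr)
  refine (mul_le_mul_of_nonneg_left hS (pow_nonneg hφ0 i)).trans ?_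
  rw [Finset.mul_sum, Finset.mul_sum]
  refine Finset.sum_le_sum fun k hk => ?_
  have hμk : μ ^ k ≤ μ ^ r := pow_le_pow_right₀ hμ (by simpa [Nat.lt_succ_iff] using hk)
  calc _ = μ ^ k * ((r.choose k * M ^ k) * |φ ^ (i + k) * D k|) := by
        rw [abs_mul, abs_of_nonneg (pow_nonneg hφ0 _)]; ring
    _ ≤ _ := by gcongr

theorem exists_enorm_phi2_pow_mul_sSup_le {a L : ℝ} {g : ℝ → ℝ} (hg : ContDiff ℝ 2 g)
    (r i j : ℕ) {b p : ℝ} (B : ℝ) (hb : 0 < b) (hp : 0 < p) :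
    ∃ C : ℝ≥0∞, C ≠ ∞ ∧ ∀ μ : ℝ, 1 ≤ μ → ∀ n : ℕ, 0 < n → ∀ P : MvPolynomial (Fin 2) ℝ,
      P.totalDegree ≤ n → ∀ q ∈ Gset a L g 1,
      ‖phi2 g n q ^ i * sSup {A : ℝ | ∃ t : ℝ, |t| ≤ min (μ * phi2 g n q) a ∧
        A = |DtanAt g (q.1 + t) r (pd2^[i + j] (fun q => evalAt q P)) q|}‖ₑ ≤
      C * ENNReal.ofReal (μ ^ r * (n : ℝ) ^ (r + 2 * j + i)) *
        (parabolaMean p b B (2 * n) (fun x => ‖evalAt x P‖ₑ) q (deriv g q.1)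
          √(g q.1 - q.2)) ^ (1 / p) := by
  obtain ⟨M, hM, hLip⟩ := hg.exists_deriv_lipschitz_Icc (2 * a)
  have h := fun k : Fin (r + 1) => exists_enorm_phi_pow_mul_evalAt_le (i := i) (j := j)
    (Nat.lt_succ_iff.mp k.2) B hb hp
  choose C hC hCb using h
  refine ⟨∑ k : Fin (r + 1), ENNReal.ofReal (r.choose k * M ^ (k : ℕ)) * C k,
    ENNReal.sum_ne_top.mpr fun k _ => ENNReal.mul_ne_top ENNReal.ofReal_ne_top (hC k),
    fun μ hμ n hn P hP q hq => ?_⟩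
  have hq1 : |q.1| ≤ a := by
    have := hq.1
    rw [one_mul] at this
    exact (abs_lt.mpr this).le
  have hμ0 : 0 ≤ μ := by linarith
  have h1 := phi2_pow_mul_sSup_le hM hLip hμ r i (i + j) n P hq1
  have h0 : 0 ≤ phi2 g n q ^ i * sSup {A : ℝ | ∃ t : ℝ, |t| ≤ min (μ * phi2 g n q) a ∧
        A = |DtanAt g (q.1 + t) r (pd2^[i + j] (fun q => evalAt q P)) q|} := by
    refine mul_nonneg (pow_nonneg (phi2_nonneg g n q) i) (Real.sSup_nonneg ?_)
    rintro _ ⟨t, -, rfl⟩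
    exact abs_nonneg _
  rw [← ofReal_norm, Real.norm_of_nonneg h0]
  refine (ENNReal.ofReal_le_ofReal h1).trans ?_
  rw [ENNReal.ofReal_mul (by positivity), Finset.sum_range,
    ENNReal.ofReal_sum_of_nonneg (fun _ _ => by positivity), ENNReal.ofReal_mul (by positivity),
    ENNReal.ofReal_pow (by positivity) (r + 2 * j + i), ENNReal.ofReal_natCast]
  set Ψ := (parabolaMean p b B (2 * n) (fun x => ‖evalAt x P‖ₑ) q (deriv g q.1)
          √(g q.1 - q.2)) ^ (1 / p)
  calc _ ≤ ENNReal.ofReal (μ ^ r) * ∑ k : Fin (r + 1), ENNReal.ofReal (r.choose k * M ^ (k : ℕ)) *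
        (C k * ((n : ℝ≥0∞) ^ (r + 2 * j + i) * Ψ)) := by
        gcongr with k _
        rw [ENNReal.ofReal_mul (by positivity), ← Real.norm_eq_abs, ofReal_norm]
        gcongr
        exact hCb k n hn P hP q _ _ (Real.sqrt_nonneg _)
    _ = _ := by
        simp only [← mul_assoc]
        rw [← Finset.sum_mul, ← Finset.sum_mul]
        ring

theorem measurableSet_Gset {a L : ℝ} {g : ℝ → ℝ} (hg : Measurable g) (lam : ℝ) :
    MeasurableSet (Gset a L g lam) := by
  refine (measurable_fst measurableSet_Ioo).inter (MeasurableSet.inter ?_ ?_)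
  · exact measurableSet_lt (by fun_prop) measurable_snd
  · exact measurableSet_le measurable_snd (by fun_prop)

theorem volume_graph_eq_zero {g : ℝ → ℝ} (hg : Measurable g) :
    volume {q : ℝ × ℝ | q.2 = g q.1} = 0 := by
  have hm : MeasurableSet {q : ℝ × ℝ | q.2 = g q.1} :=
    measurableSet_eq_fun measurable_snd (by fun_prop)
  rw [Measure.volume_eq_prod, Measure.measure_prod_null hm]
  refine Filter.Eventually.of_forall fun x => ?_
  have : Prod.mk x ⁻¹' {q : ℝ × ℝ | q.2 = g q.1} = {g x} := by ext y; simp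
  show volume (Prod.mk x ⁻¹' {q : ℝ × ℝ | q.2 = g q.1}) = 0
  rw [this, Real.volume_singleton]

/-- On `G` the parabolic means only see the values of a function on `G(λ)`. -/
theorem parabolaMean_le_of_eqOn {a L lam b B : ℝ} {g : ℝ → ℝ}
    (h : ∀ q ∈ Gset a L g 1, ∀ s, |s| ≤ b → ∀ z ∈ Icc (1 : ℝ) 2, ∀ β ∈ Icc B (B + 1),
      (q.1 + s, q.2 + (deriv g q.1 + z * √(g q.1 - q.2)) * s - β * s ^ 2) ∈ Gset a L g lam)
    (hb : 0 ≤ b) {p : ℝ} (hp : 0 ≤ p) (N : ℕ) {Θ Θ' : ℝ × ℝ → ℝ≥0∞}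
    (hΘ : ∀ x ∈ Gset a L g lam, Θ x ≤ Θ' x) {q : ℝ × ℝ} (hq : q ∈ Gset a L g 1) :
    parabolaMean p b B N Θ q (deriv g q.1) √(g q.1 - q.2) ≤
      parabolaMean p b B N Θ' q (deriv g q.1) √(g q.1 - q.2) := by
  refine setLIntegral_mono' measurableSet_Icc fun β hβ => lintegral_mono fun t =>
    setLIntegral_mono' measurableSet_Icc fun z hz => ?_
  refine ENNReal.rpow_le_rpow (hΘ _ (h q hq _ ?_ z hz β hβ)) hp
  rw [abs_mul, abs_of_nonneg hb]
  exact mul_le_of_le_one_right hb (Real.abs_sin_le_one _)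

theorem lintegral_Gset_parabolaMean_le {a L lam b B : ℝ} {g : ℝ → ℝ} (hg : ContDiff ℝ 2 g)
    (h : ∀ q ∈ Gset a L g 1, ∀ s, |s| ≤ b → ∀ z ∈ Icc (1 : ℝ) 2, ∀ β ∈ Icc B (B + 1),
      (q.1 + s, q.2 + (deriv g q.1 + z * √(g q.1 - q.2)) * s - β * s ^ 2) ∈ Gset a L g lam)
    (hb : 0 ≤ b) {p : ℝ} (hp : 0 < p) (N : ℕ) {Θ : ℝ × ℝ → ℝ≥0∞} (hΘ : Measurable Θ) :
    ∫⁻ q in Gset a L g 1, parabolaMean p b B N Θ q (deriv g q.1) √(g q.1 - q.2) ≤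
      4 * lineMeasure univ * ∫⁻ q in Gset a L g lam, Θ q ^ p := by
  have hgm := hg.continuous.measurable
  have hlm := measurableSet_Gset (a := a) (L := L) hgm lam
  have hsub : Gset a L g 1 ≤ᵐ[volume] {q : ℝ × ℝ | q.2 < g q.1} := by
    have h0 : ∀ᵐ q : ℝ × ℝ, ¬ q.2 = g q.1 := by
      rw [ae_iff]; simpa using volume_graph_eq_zero hgm
    filter_upwards [h0] with q hne hq
    exact lt_of_le_of_ne hq.2.2 hne
  calc _ ≤ ∫⁻ q in Gset a L g 1, parabolaMean p b B N ((Gset a L g lam).indicator Θ) q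
        (deriv g q.1) √(g q.1 - q.2) :=
        setLIntegral_mono' (measurableSet_Gset hgm 1) fun q hq =>
          parabolaMean_le_of_eqOn h hb hp.le N
            (fun x hx => by rw [indicator_of_mem hx]) hq
    _ ≤ ∫⁻ q in {q : ℝ × ℝ | q.2 < g q.1}, parabolaMean p b B N
        ((Gset a L g lam).indicator Θ) q (deriv g q.1) √(g q.1 - q.2) :=
        lintegral_mono' (Measure.restrict_mono_ae hsub) le_rfl
    _ ≤ 4 * lineMeasure univ * ∫⁻ q, (Gset a L g lam).indicator Θ q ^ p :=
        setLIntegral_parabolaMean_le (hΘ.indicator hlm) hgm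
          (hg.continuous_deriv one_le_two).measurable p b B N
    _ = _ := by
        rw [← lintegral_indicator hlm]
        congr 2 with q
        by_cases hq : q ∈ Gset a L g lam <;> simp [hq, hp]

/-- Continuous functions on `G(λ)` are bounded everywhere by their essential supremum. -/
theorem enorm_le_eLpNorm_top_Gset {a L lam : ℝ} {g : ℝ → ℝ}
    (hg : Continuous g) {f : ℝ × ℝ → ℝ} (hf : Continuous f) {x : ℝ × ℝ}
    (hx : x ∈ Gset a L g lam) :
    ‖f x‖ₑ ≤ eLpNorm f ∞ (volume.restrict (Gset a L g lam)) := by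
  set S := eLpNorm f ∞ (volume.restrict (Gset a L g lam)) with hS
  by_contra! hlt
  set O : Set (ℝ × ℝ) := {q | q.1 ∈ Ioo (-(lam * a)) (lam * a) ∧ g q.1 - lam * L * a < q.2 ∧
    q.2 < g q.1} with hO
  have hOG : O ⊆ Gset a L g lam := fun q hq => ⟨hq.1, hq.2.1, hq.2.2.le⟩
  have hOo : IsOpen O := (isOpen_Ioo.preimage continuous_fst).inter
    ((isOpen_lt (by fun_prop) continuous_snd).inter (isOpen_lt continuous_snd (by fun_prop)))
  have hVo : IsOpen {q | S < ‖f q‖ₑ} := isOpen_lt continuous_const hf.enorm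
  have hxO : x ∈ closure O := by
    have hlim : Filter.Tendsto (fun y => (x.1, y)) (nhdsWithin x.2 (Iio x.2)) (nhds x) :=
      (Continuous.tendsto (by fun_prop) x.2).mono_left nhdsWithin_le_nhds
    refine mem_closure_of_tendsto hlim ?_
    filter_upwards [Ioo_mem_nhdsLT hx.2.1] with y hy
    exact ⟨hx.1, hy.1, hy.2.trans_le hx.2.2⟩
  have hne : (O ∩ {q | S < ‖f q‖ₑ}).Nonempty := by
    rw [inter_comm]
    exact mem_closure_iff.mp hxO _ hVo hlt
  have hpos := (hOo.inter hVo).measure_pos volume hne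
  have hae : ∀ᵐ q ∂volume.restrict (Gset a L g lam), ‖f q‖ₑ ≤ S := by
    rw [hS, eLpNorm_exponent_top]
    exact ae_le_eLpNormEssSup
  have h0 : volume (O ∩ {q | S < ‖f q‖ₑ}) = 0 := by
    have h1 := ae_restrict_of_ae_restrict_of_subset hOG hae
    rw [ae_restrict_iff' hOo.measurableSet, ae_iff] at h1
    refine measure_mono_null (fun q hq => ?_) h1
    simpa using ⟨hq.1, hq.2⟩
  exact hpos.ne' h0

theorem parabolaMean_const (S : ℝ≥0∞) (b B : ℝ) (N : ℕ) (q : ℝ × ℝ) (d v : ℝ) :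
    parabolaMean 1 b B N (fun _ => S) q d v = S * lineMeasure univ := by
  simp only [parabolaMean, ENNReal.rpow_one, lintegral_const, Measure.restrict_apply_univ,
    Real.volume_Icc, add_sub_cancel_left]
  norm_num

/-- **Corollary 4.2** (maximal Bernstein type inequality on domains of special type in `ℝ²`):
`‖φ_n^i max_{|t| ≤ min{μφ_n, a}} |D_{x+t}^r ∂₂^{i+j} f|‖_{L^p(G)} ≤ c μ^r n^{r+2j+i} ‖f‖_{L^p(G(λ))}`,
with `c` independent of `f`, `n` and `μ`. -/
theorem bernstein_special_2d_max (a L : ℝ) (ha : 0 < a) (hL : 1 ≤ L)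
    (g : ℝ → ℝ) (hg : ContDiff ℝ 2 g)
    (hgmin₁ : ∀ x ∈ Icc (-(2 * a)) (2 * a), 4 * L * a ≤ g x)
    (hgmin₂ : ∃ x ∈ Icc (-(2 * a)) (2 * a), g x = 4 * L * a)
    (p : ℝ≥0∞) (hp : 0 < p) (lam : ℝ) (hlam : 1 < lam) (r i j : ℕ) :
    ∃ c : ℝ, 0 < c ∧ ∀ μ : ℝ, 1 < μ → ∀ (n : ℕ), 0 < n → ∀ f : ℝ × ℝ → ℝ, IsPoly2 n f →
      eLpNorm
          (fun q => phi2 g n q ^ i *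
            sSup {A : ℝ | ∃ t : ℝ, |t| ≤ min (μ * phi2 g n q) a ∧
              A = |DtanAt g (q.1 + t) r (pd2^[i + j] f) q|})
          p (volume.restrict (Gset a L g 1))
        ≤ ENNReal.ofReal (c * μ ^ r * (n : ℝ) ^ (r + 2 * j + i)) *
            eLpNorm f p (volume.restrict (Gset a L g lam)) := by
  obtain ⟨b, B, hb, hpar⟩ := exists_parabola_mem_Gset ha hL hlam hg
  have hGm := measurableSet_Gset (a := a) (L := L) hg.continuous.measurable 1
  suffices h : ∃ C : ℝ≥0∞, C ≠ ∞ ∧ ∀ μ : ℝ, 1 < μ → ∀ (n : ℕ), 0 < n →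
      ∀ P : MvPolynomial (Fin 2) ℝ, P.totalDegree ≤ n →
      eLpNorm
          (fun q => phi2 g n q ^ i *
            sSup {A : ℝ | ∃ t : ℝ, |t| ≤ min (μ * phi2 g n q) a ∧
              A = |DtanAt g (q.1 + t) r (pd2^[i + j] (fun q => evalAt q P)) q|})
          p (volume.restrict (Gset a L g 1))
        ≤ C * ENNReal.ofReal (μ ^ r * (n : ℝ) ^ (r + 2 * j + i)) *
            eLpNorm (fun q => evalAt q P) p (volume.restrict (Gset a L g lam)) by
    obtain ⟨C, hC, h⟩ := h
    refine ⟨C.toReal + 1, by positivity, fun μ hμ n hn f hf => ?_⟩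
    obtain ⟨P, hP, hfP⟩ := hf
    obtain rfl : f = fun q => evalAt q P := funext hfP
    refine (h μ hμ n hn P hP).trans (mul_le_mul_left ?_ _)
    rw [mul_assoc (C.toReal + 1), ENNReal.ofReal_mul (p := C.toReal + 1) (by positivity)]
    gcongr
    exact (ENNReal.ofReal_toReal hC).ge.trans (ENNReal.ofReal_le_ofReal (by linarith))
  rcases eq_or_ne p ∞ with rfl | hpt
  · obtain ⟨C, hC, h⟩ := exists_enorm_phi2_pow_mul_sSup_le (a := a) (L := L) hg r i j B hb
      zero_lt_one
    refine ⟨C * lineMeasure univ, ENNReal.mul_ne_top hC (measure_ne_top _ _),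
      fun μ hμ n hn P hP => ?_⟩
    set S := eLpNorm (fun q => evalAt q P) ∞ (volume.restrict (Gset a L g lam)) with hS
    rw [eLpNorm_exponent_top]
    refine essSup_le_of_ae_le _ ?_
    filter_upwards [ae_restrict_mem hGm] with q hq
    refine (h μ hμ.le n hn P hP q hq).trans ?_
    have hmean := parabolaMean_le_of_eqOn hpar hb.le zero_le_one (2 * n)
      (Θ := fun x => ‖evalAt x P‖ₑ) (Θ' := fun _ => S)
      (fun x hx => enorm_le_eLpNorm_top_Gset hg.continuous (continuous_evalAt P) hx) hq
    rw [parabolaMean_const] at hmean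
    rw [div_one, ENNReal.rpow_one]
    refine (mul_le_mul_right hmean _).trans_eq ?_
    ring
  · have hp' : 0 < p.toReal := ENNReal.toReal_pos hp.ne' hpt
    obtain ⟨C, hC, h⟩ := exists_enorm_phi2_pow_mul_sSup_le (a := a) (L := L) hg r i j B hb hp'
    refine ⟨C * (4 * lineMeasure univ) ^ (1 / p.toReal), ENNReal.mul_ne_top hC
      (ENNReal.rpow_ne_top_of_nonneg (by positivity) (by finiteness)), fun μ hμ n hn P hP => ?_⟩
    have hp1 : 0 ≤ 1 / p.toReal := by positivity
    rw [eLpNorm_eq_lintegral_rpow_enorm_toReal hp.ne' hpt,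
      eLpNorm_eq_lintegral_rpow_enorm_toReal hp.ne' hpt]
    set T := C * ENNReal.ofReal (μ ^ r * (n : ℝ) ^ (r + 2 * j + i)) with hT
    have hTtop : T ^ p.toReal ≠ ∞ := ENNReal.rpow_ne_top_of_nonneg hp'.le
      (ENNReal.mul_ne_top hC ENNReal.ofReal_ne_top)
    set J := ∫⁻ q in Gset a L g lam, ‖evalAt q P‖ₑ ^ p.toReal with hJ
    have key := lintegral_Gset_parabolaMean_le hg hpar hb.le hp' (2 * n)
      (continuous_evalAt P).enorm.measurable
    calc _ ≤ (∫⁻ q in Gset a L g 1, T ^ p.toReal * parabolaMean p.toReal b B (2 * n)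
          (fun x => ‖evalAt x P‖ₑ) q (deriv g q.1) √(g q.1 - q.2)) ^ (1 / p.toReal) := by
          refine ENNReal.rpow_le_rpow (setLIntegral_mono' hGm fun q hq => ?_) hp1
          refine (ENNReal.rpow_le_rpow (h μ hμ.le n hn P hP q hq) hp'.le).trans_eq ?_
          rw [ENNReal.mul_rpow_of_nonneg _ _ hp'.le, ← ENNReal.rpow_mul, one_div_mul_cancel hp'.ne',
            ENNReal.rpow_one]
      _ ≤ (T ^ p.toReal * (4 * lineMeasure univ * J)) ^ (1 / p.toReal) := by
          rw [lintegral_const_mul' _ _ hTtop]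
          gcongr
      _ = _ := by
          rw [ENNReal.mul_rpow_of_nonneg _ _ hp1, ENNReal.mul_rpow_of_nonneg _ _ hp1,
            ← ENNReal.rpow_mul, mul_one_div_cancel hp'.ne', ENNReal.rpow_one, hT]
          ring
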